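/- arXiv:1908.03648 — 5 statements merged into one kernel-verified Lean document; each statement's English description precedes it below -/
import Mathlib

section
/- If the ideal I generated by the n×n minors of φ has codimension 3, then b_i > a_i for every i = 1, …, n. -/
open MvPolynomial

/-- The height (codimension) of an ideal: the infimum of the heights of the
prime ideals containing it. -/
noncomputable def idealHeight {R : Type*} [CommRing R] (I : Ideal R) : ℕ∞ :=
  ⨅ (p : PrimeSpectrum R) (_ : I ≤ p.asIdeal), Order.height p

namespace Matrix

variable {ι κ A : Type*} [CommRing A]

/-- The rows of `M` are linearly dependent modulo the ideal `P`. -/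
def RowsDependentMod [Fintype ι] (M : Matrix ι κ A) (P : Ideal A) : Prop :=
  ∃ y : ι → A, (∃ i, y i ∉ P) ∧ ∀ j, ∑ i, y i * M i j ∈ P

/-- A form of the ideal of maximal minors of `M` which does not refer to submatrices. -/
def maxMinors [Fintype ι] [DecidableEq ι] [Fintype κ] (M : Matrix ι κ A) : Ideal A :=
  Ideal.span (Set.range fun N : Matrix κ ι A => (M * N).det)

lemma RowsDependentMod.det_mem [Fintype ι] [DecidableEq ι] {M : Matrix ι ι A} {P : Ideal A}
    [P.IsPrime] (h : M.RowsDependentMod P) : M.det ∈ P := by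
  obtain ⟨y, ⟨i, hi⟩, hy⟩ := h
  have key : y ᵥ* M ᵥ* M.adjugate = M.det • y := by
    rw [vecMul_vecMul, mul_adjugate, vecMul_smul, vecMul_one]
  have hk : y i * M.det ∈ P := by
    have := congrFun key i
    simp only [Pi.smul_apply, smul_eq_mul] at this
    rw [mul_comm, ← this]
    exact Ideal.sum_mem _ fun j _ => P.mul_mem_right _ (hy j)
  exact (Ideal.IsPrime.mem_or_mem ‹_› hk).resolve_left hi

lemma RowsDependentMod.mul [Fintype ι] [Fintype κ] {μ : Type*} {M : Matrix ι κ A} {P : Ideal A}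
    (h : M.RowsDependentMod P) (N : Matrix κ μ A) : (M * N).RowsDependentMod P := by
  obtain ⟨y, hi, hy⟩ := h
  refine ⟨y, hi, fun j => ?_⟩
  have : ∑ i, y i * (M * N) i j = ∑ k, (∑ i, y i * M i k) * N k j := by
    simp only [mul_apply, Finset.mul_sum, Finset.sum_mul, mul_assoc]
    exact Finset.sum_comm
  rw [this]
  exact Ideal.sum_mem _ fun k _ => P.mul_mem_right _ (hy k)

lemma exists_lift_fractionRing_quotient [Finite ι] (P : Ideal A) [P.IsPrime]
    (v : ι → FractionRing (A ⧸ P)) :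
    ∃ c : A, c ∉ P ∧ ∃ w : ι → A, ∀ i,
      algebraMap (A ⧸ P) (FractionRing (A ⧸ P)) (Ideal.Quotient.mk P (w i)) =
        algebraMap (A ⧸ P) (FractionRing (A ⧸ P)) (Ideal.Quotient.mk P c) * v i := by
  obtain ⟨b, hb⟩ := IsLocalization.exist_integer_multiples_of_finite
    (nonZeroDivisors (A ⧸ P)) v
  obtain ⟨c, hc⟩ := Ideal.Quotient.mk_surjective (b : A ⧸ P)
  choose w hw using hb
  choose w' hw' using fun i => Ideal.Quotient.mk_surjective (w i)
  refine ⟨c, fun h => nonZeroDivisors.ne_zero b.2 ?_, w', fun i => ?_⟩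
  · rw [← hc, Ideal.Quotient.eq_zero_iff_mem.mpr h]
  · rw [hw', hw, hc, Algebra.smul_def]

lemma maxMinors_le_iff [Fintype ι] [DecidableEq ι] [Fintype κ] (M : Matrix ι κ A)
    (P : Ideal A) [P.IsPrime] : M.maxMinors ≤ P ↔ M.RowsDependentMod P := by
  classical
  constructor
  · intro h
    let f : A →+* FractionRing (A ⧸ P) := (algebraMap _ _).comp (Ideal.Quotient.mk P)
    have hf (x : A) : f x = 0 ↔ x ∈ P := by
      simp [f, Ideal.Quotient.eq_zero_iff_mem]
    by_cases hinj : LinearMap.ker (M.map f).vecMulLinear = ⊥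
    · exfalso
      obtain ⟨L, hL⟩ := LinearMap.exists_leftInverse_of_injective _ hinj
      let N : Matrix κ ι (FractionRing (A ⧸ P)) := LinearMap.toMatrixRight' L
      have hN : M.map f * N = 1 := by
        refine ext_of_single_vecMul fun i => ?_
        have h1 := LinearMap.congr_fun hL (Pi.single i 1)
        have h2 : L (Pi.single i 1 ᵥ* M.map f) = (Pi.single i 1 ᵥ* M.map f) ᵥ* N := by
          conv_lhs => rw [← Matrix.toLinearMapRight'.apply_symm_apply L]
          rfl
        rw [← vecMul_vecMul, ← h2, vecMul_one]
        exact h1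
      obtain ⟨c, hc, w, hw⟩ := exists_lift_fractionRing_quotient P fun p : κ × ι => N p.1 p.2
      let N₀ : Matrix κ ι A := of fun k i => w (k, i)
      have hN₀ : N₀.map f = f c • N := by
        ext k i
        exact hw (k, i)
      have hdet : f (M * N₀).det = f c ^ Fintype.card ι := by
        rw [RingHom.map_det, RingHom.mapMatrix_apply, Matrix.map_mul, hN₀, Matrix.mul_smul, hN,
          det_smul, det_one, mul_one]
      have h0 : f (M * N₀).det = 0 := (hf _).mpr (h (Ideal.subset_span ⟨N₀, rfl⟩))
      exact hc ((hf c).mp (eq_zero_of_pow_eq_zero (hdet.symm.trans h0)))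
    · obtain ⟨v, hv, hv0⟩ := Submodule.exists_mem_ne_zero_of_ne_bot hinj
      obtain ⟨c, hc, w, hw⟩ := exists_lift_fractionRing_quotient P v
      obtain ⟨i, hi⟩ := Function.ne_iff.mp hv0
      refine ⟨w, ⟨i, fun hwi => ?_⟩, fun j => (hf _).mp ?_⟩
      · have := (hf _).mpr hwi
        rw [show f (w i) = f c * v i from hw i, mul_eq_zero, hf] at this
        exact this.elim hc hi
      · have hj : ∑ i, v i * f (M i j) = 0 := congrFun hv j
        have hw' (i) : f (w i) = f c * v i := hw i
        simp only [map_sum, map_mul, hw', mul_assoc]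
        rw [← Finset.mul_sum, hj, mul_zero]
  · intro h
    refine Ideal.span_le.mpr ?_
    rintro _ ⟨N, rfl⟩
    exact (h.mul N).det_mem

lemma RowsDependentMod.mono [Fintype ι] [Finite κ] {M : Matrix ι κ A} {P Q : Ideal A}
    [P.IsPrime] [Q.IsPrime] (h : M.RowsDependentMod P) (hPQ : P ≤ Q) :
    M.RowsDependentMod Q := by
  classical
  have := Fintype.ofFinite κ
  rw [← maxMinors_le_iff] at h ⊢
  exact h.trans hPQ

/-- Clear the column `j₀` of `M` using the pivot `M i₀ j₀`, without dividing by it, and delete the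
row and the column of the pivot. -/
def pivot {m n : ℕ} (M : Matrix (Fin (m + 1)) (Fin (n + 1)) A) (i₀ : Fin (m + 1))
    (j₀ : Fin (n + 1)) : Matrix (Fin m) (Fin n) A :=
  of fun i j => M i₀ j₀ * M (i₀.succAbove i) (j₀.succAbove j)
    - M (i₀.succAbove i) j₀ * M i₀ (j₀.succAbove j)

lemma rowsDependentMod_pivot_iff {m n : ℕ} {M : Matrix (Fin (m + 1)) (Fin (n + 1)) A}
    {i₀ : Fin (m + 1)} {j₀ : Fin (n + 1)} {Q : Ideal A} [hQ : Q.IsPrime] (hu : M i₀ j₀ ∉ Q) :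
    (M.pivot i₀ j₀).RowsDependentMod Q ↔ M.RowsDependentMod Q := by
  have sum_pivot (z : Fin m → A) (j : Fin n) : ∑ i, z i * M.pivot i₀ j₀ i j =
      M i₀ j₀ * (∑ i, z i * M (i₀.succAbove i) (j₀.succAbove j))
        - (∑ i, z i * M (i₀.succAbove i) j₀) * M i₀ (j₀.succAbove j) := by
    rw [Finset.mul_sum, Finset.sum_mul, ← Finset.sum_sub_distrib]
    refine Finset.sum_congr rfl fun i _ => ?_
    simp only [pivot, of_apply]
    ring
  constructor
  · rintro ⟨z, ⟨i, hi⟩, hz⟩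
    refine ⟨i₀.insertNth (-∑ i, z i * M (i₀.succAbove i) j₀) (fun i => M i₀ j₀ * z i),
      ⟨i₀.succAbove i, ?_⟩, fun j => ?_⟩
    · rw [Fin.insertNth_apply_succAbove]
      exact fun h => (hQ.mem_or_mem h).elim hu hi
    · rw [Fin.sum_univ_succAbove _ i₀]
      simp only [Fin.insertNth_apply_same, Fin.insertNth_apply_succAbove, mul_assoc]
      rw [← Finset.mul_sum]
      induction j using j₀.succAboveCases with
      | x =>
        convert Q.zero_mem using 1
        ring
      | p j =>
        convert hz j using 1
        rw [sum_pivot]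
        ring
  · rintro ⟨y, ⟨i, hi⟩, hy⟩
    simp only [Fin.sum_univ_succAbove _ i₀] at hy
    refine ⟨fun i => y (i₀.succAbove i), ?_, fun j => ?_⟩
    · by_contra! hall
      have h₀ : y i₀ * M i₀ j₀ ∈ Q :=
        (Ideal.add_mem_iff_left _ (Ideal.sum_mem _ fun i _ => Q.mul_mem_right _ (hall i))).mp
          (hy j₀)
      have h₁ := (hQ.mem_or_mem h₀).resolve_right hu
      induction i using i₀.succAboveCases with
      | x => exact hi h₁
      | p i => exact hi (hall i)
    · rw [sum_pivot]
      convert Q.sub_mem (Q.mul_mem_left (M i₀ j₀) (hy (j₀.succAbove j)))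
        (Q.mul_mem_right (M i₀ (j₀.succAbove j)) (hy j₀)) using 1
      ring

end Matrix

lemma Ideal.height_le_height_map_C {A : Type*} [CommRing A] (P : Ideal A) [P.IsPrime] :
    P.height ≤ (P.map (Polynomial.C : A →+* Polynomial A)).height := by
  let F (q : PrimeSpectrum A) : PrimeSpectrum (Polynomial A) :=
    ⟨q.asIdeal.map Polynomial.C, Ideal.isPrime_map_C_of_isPrime⟩
  have hle (q r : PrimeSpectrum A) : F q ≤ F r ↔ q ≤ r := by
    refine ⟨fun h x hx => ?_, fun h => Ideal.map_mono h⟩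
    simpa using Ideal.mem_map_C_iff.mp (h (Ideal.mem_map_of_mem Polynomial.C hx)) 0
  have hF : StrictMono F := fun q r h => by
    rw [lt_iff_le_not_ge] at h ⊢
    rwa [hle, hle]
  have := Order.height_le_height_apply_of_strictMono F hF ⟨P, ‹_›⟩
  rw [← PrimeSpectrum.height_eq_orderHeight, ← PrimeSpectrum.height_eq_orderHeight] at this
  exact this

lemma Ideal.le_of_mem_minimalPrimes_sup_span_singleton {A : Type*} [CommRing A]
    [IsNoetherianRing A] {Q P' P : Ideal A} [Q.IsPrime] [P'.IsPrime] {x : A}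
    (hP : P ∈ (Q ⊔ Ideal.span {x}).minimalPrimes) (hQ : Q ≤ P') (hlt : P' < P) : P' ≤ Q := by
  let f := Ideal.Quotient.mk Q
  have hf : Function.Surjective f := Ideal.Quotient.mk_surjective
  have h1 : (P.map f).height ≤ 1 := Ideal.map_height_le_one_of_mem_minimalPrimes hP
  have := hP.isPrime
  have hker {J : Ideal A} (hJ : Q ≤ J) : (J.map f).comap f = J := by
    rw [Ideal.comap_map_of_surjective f hf, ← RingHom.ker_eq_comap_bot, Ideal.mk_ker,
      sup_eq_left.mpr hJ]
  have : (P'.map f).IsPrime := Ideal.map_isPrime_of_surjective hf (by rwa [Ideal.mk_ker])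
  have : (P.map f).IsPrime :=
    Ideal.map_isPrime_of_surjective hf (by rw [Ideal.mk_ker]; exact hQ.trans hlt.le)
  have hlt' : P'.map f < P.map f := (Ideal.map_mono hlt.le).lt_of_not_ge fun e => hlt.not_ge <| by
    simpa only [hker hQ, hker (hQ.trans hlt.le)] using Ideal.comap_mono (f := f) e
  have h0 := (Ideal.height_strict_mono_of_isPrime_of_isPrime hlt').trans_le h1
  rw [Order.lt_one_iff, Ideal.height_eq_zero_iff_eq_bot, Ideal.map_eq_bot_iff_le_ker,
    Ideal.mk_ker] at h0
  exact h0

namespace Matrix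

/-- Adding an indeterminate to an entry of a matrix with entries in `P` preserves minimality
of `P` among the primes modulo which the rows are dependent. -/
lemma map_C_le_of_rowsDependentMod_add_single {m n : ℕ} {A : Type*} [CommRing A]
    [IsNoetherianRing A] {M : Matrix (Fin m) (Fin n) A} {P : Ideal A} [hP : P.IsPrime]
    (hmin : ∀ Q : Ideal A, Q.IsPrime → Q ≤ P → M.RowsDependentMod Q → P ≤ Q)
    (i₀ : Fin m) (j₀ : Fin n) {Q : Ideal (Polynomial A)} [Q.IsPrime]
    (hQP : Q ≤ P.map Polynomial.C)
    (hQ : (M.map Polynomial.C + Matrix.single i₀ j₀ Polynomial.X).RowsDependentMod Q) :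
    P.map Polynomial.C ≤ Q := by
  have hPC : (P.map (Polynomial.C : A →+* Polynomial A)).IsPrime := Ideal.isPrime_map_C_of_isPrime
  let 𝔐 : Ideal (Polynomial A) := P.comap Polynomial.constantCoeff
  have h𝔐 : 𝔐.IsPrime := Ideal.IsPrime.comap _
  have hX : (Polynomial.X : Polynomial A) ∈ 𝔐 := by simp [𝔐, Ideal.mem_comap]
  have hle : P.map Polynomial.C ≤ 𝔐 := fun f hf => Ideal.mem_map_C_iff.mp hf 0
  have hlt : P.map Polynomial.C < 𝔐 := by
    refine lt_of_le_of_ne hle fun h => hP.one_notMem ?_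
    rw [← Polynomial.coeff_X_one (R := A)]
    exact Ideal.mem_map_C_iff.mp (h ▸ hX) 1
  refine Ideal.le_of_mem_minimalPrimes_sup_span_singleton (P := 𝔐) (x := Polynomial.X)
    ⟨⟨h𝔐, ?_⟩, ?_⟩ hQP hlt
  · exact sup_le (hQP.trans hle) ((Ideal.span_singleton_le_iff_mem _).mpr hX)
  rintro J ⟨hJ, hQJ⟩ hJ𝔐
  have hXJ : (Polynomial.X : Polynomial A) ∈ J :=
    (Ideal.span_singleton_le_iff_mem _).mp (le_sup_right.trans hQJ)
  have hJC : (J.comap Polynomial.C).IsPrime := Ideal.IsPrime.comap _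
  have hmod (f : Polynomial A) : f - Polynomial.C (f.coeff 0) ∈ J :=
    J.mem_of_dvd (by rw [Polynomial.X_dvd_iff]; simp) hXJ
  have hdep : M.RowsDependentMod (J.comap Polynomial.C) := by
    obtain ⟨y, ⟨i, hi⟩, hy⟩ := hQ.mono (le_sup_left.trans hQJ)
    refine ⟨fun i => (y i).coeff 0, ⟨i, fun h => hi ?_⟩, fun j => ?_⟩
    · simpa using J.add_mem (hmod (y i)) h
    · rw [Ideal.mem_comap]
      have := J.sub_mem (hy j) (hmod (∑ i, y i *
        (M.map Polynomial.C + Matrix.single i₀ j₀ Polynomial.X : Matrix _ _ (Polynomial A)) i j))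
      rw [sub_sub_cancel] at this
      convert this using 2
      rw [Polynomial.finsetSum_coeff]
      refine Finset.sum_congr rfl fun k _ => ?_
      rw [Polynomial.mul_coeff_zero, add_apply, map_apply, Polynomial.coeff_add,
        Polynomial.coeff_C_zero]
      by_cases h : i₀ = k ∧ j₀ = j
      · obtain ⟨rfl, rfl⟩ := h
        simp
      · rw [Matrix.single_apply_of_ne _ _ _ _ _ h]
        simp
  have hPJ : P ≤ J.comap Polynomial.C := hmin _ hJC (fun a ha => by simpa [𝔐] using hJ𝔐 ha) hdep
  intro f hf
  simpa using J.add_mem (hmod f) (hPJ hf)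

/-- A prime minimal among those modulo which the rows of an `m × (m + 1)` matrix are dependent,
with `m > 0`, has height at most two. -/
theorem height_le_two_of_rowsDependentMod (m : ℕ) {A : Type*} [CommRing A]
    [IsNoetherianRing A] (M : Matrix (Fin (m + 1)) (Fin (m + 2)) A) (P : Ideal A)
    [hP : P.IsPrime] (hdep : M.RowsDependentMod P)
    (hmin : ∀ Q : Ideal A, Q.IsPrime → Q ≤ P → M.RowsDependentMod Q → P ≤ Q) :
    P.height ≤ 2 := by
  induction m generalizing A with
  | zero =>
    have hiff (Q : Ideal A) (hQ : Q.IsPrime) :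
        M.RowsDependentMod Q ↔ ({M 0 0, M 0 1} : Set A) ⊆ Q := by
      simp only [Set.insert_subset_iff, Set.singleton_subset_iff, SetLike.mem_coe]
      constructor
      · rintro ⟨y, ⟨i, hi⟩, hy⟩
        obtain rfl : i = 0 := Fin.fin_one_eq_zero i
        have hM (j) : M 0 j ∈ Q :=
          (hQ.mem_or_mem (by simpa using hy j : y 0 * M 0 j ∈ Q)).resolve_left hi
        exact ⟨hM 0, hM 1⟩
      · rintro ⟨h0, h1⟩
        have hM : ∀ j : Fin 2, M 0 j ∈ Q := Fin.forall_fin_two.mpr ⟨h0, h1⟩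
        exact ⟨1, ⟨0, hQ.one_notMem⟩, fun j => by simpa using hM j⟩
    refine (Ideal.height_le_card_of_mem_minimalPrimes_span (s := {M 0 0, M 0 1}) (by simp)
      ⟨⟨hP, Ideal.span_le.mpr ((hiff P hP).mp hdep)⟩, ?_⟩).trans ?_
    · rintro Q ⟨hQ, hQM⟩ hQP
      exact hmin Q hQ hQP ((hiff Q hQ).mpr (Ideal.span_le.mp hQM))
    · exact_mod_cast Set.ncard_insert_le (M 0 0) {M 0 1} |>.trans (by simp)
  | succ m ih =>
    have of_pivot {B : Type _} [CommRing B] [IsNoetherianRing B]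
        (N : Matrix (Fin (m + 1 + 1)) (Fin (m + 1 + 2)) B) (p : Ideal B) [p.IsPrime]
        (hd : N.RowsDependentMod p)
        (hm : ∀ Q : Ideal B, Q.IsPrime → Q ≤ p → N.RowsDependentMod Q → p ≤ Q)
        (i₀ j₀) (hu : N i₀ j₀ ∉ p) : p.height ≤ 2 :=
      ih (N.pivot i₀ j₀) p ((rowsDependentMod_pivot_iff hu).mpr hd) fun Q hQ hQp h =>
        hm Q hQ hQp ((rowsDependentMod_pivot_iff fun h => hu (hQp h)).mp h)
    by_cases hall : ∀ i j, M i j ∈ P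
    · have hPC : (P.map (Polynomial.C : A →+* Polynomial A)).IsPrime :=
        Ideal.isPrime_map_C_of_isPrime
      refine (Ideal.height_le_height_map_C P).trans
        (of_pivot (M.map Polynomial.C + Matrix.single 0 0 Polynomial.X) (P.map Polynomial.C)
          ?_ ?_ 0 0 ?_)
      · refine ⟨Pi.single 1 1, ⟨1, by simpa using hPC.one_notMem⟩, fun j => ?_⟩
        have h : ∑ i, (Pi.single 1 1 : Fin (m + 2) → Polynomial A) i *
            (M.map Polynomial.C + Matrix.single 0 0 Polynomial.X : Matrix _ _ (Polynomial A)) i j =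
              Polynomial.C (M 1 j) := by
          simp [Pi.single_apply]
        rw [h]
        exact Ideal.mem_map_of_mem _ (hall 1 j)
      · exact fun Q hQ hQP h => map_C_le_of_rowsDependentMod_add_single hmin 0 0 hQP h
      · intro h
        have := Ideal.mem_map_C_iff.mp h 1
        simp at this
        exact hP.one_notMem this
    · push Not at hall
      obtain ⟨i₀, j₀, hu⟩ := hall
      exact of_pivot M P hdep hmin i₀ j₀ hu

/-- If `M` is an `m × (m + 1)` matrix with `m > 0` whose entries all lie in a prime ideal, then
there is a prime of height at most two modulo which the rows of `M` are dependent. -/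
lemma exists_height_le_two_rowsDependentMod {m : ℕ} {A : Type*} [CommRing A]
    [IsNoetherianRing A] (M : Matrix (Fin (m + 1)) (Fin (m + 2)) A) {𝔪 : Ideal A}
    [h𝔪 : 𝔪.IsPrime] (hM : ∀ i j, M i j ∈ 𝔪) :
    ∃ P : Ideal A, P.IsPrime ∧ M.RowsDependentMod P ∧ P.height ≤ 2 := by
  have hle : M.maxMinors ≤ 𝔪 := (maxMinors_le_iff M 𝔪).mpr
    ⟨1, ⟨0, h𝔪.one_notMem⟩, fun j => Ideal.sum_mem _ fun i _ => 𝔪.mul_mem_left _ (hM i j)⟩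
  obtain ⟨P, hP, -⟩ := Ideal.exists_minimalPrimes_le hle
  have hPp := hP.isPrime
  have hdep := (maxMinors_le_iff M P).mp hP.1.2
  refine ⟨P, hPp, hdep, height_le_two_of_rowsDependentMod m M P hdep fun Q hQ hQP h => ?_⟩
  exact hP.2 ⟨hQ, (maxMinors_le_iff M Q).mpr h⟩ hQP

end Matrix

/-- If the ideal `I` generated by the `n × n` minors of `φ` has
codimension `3`, then `b i > a i` for every `i = 1, …, n`. -/
theorem stmt0 {K : Type*} [Field K] [IsAlgClosed K]
    (n : ℕ) (hn : 0 < n) (a : Fin n → ℤ) (b : Fin (n + 2) → ℤ)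
    (ha : Monotone a) (hb : Monotone b)
    (φ : Matrix (Fin n) (Fin (n + 2)) (MvPolynomial (Fin 3) K))
    -- each entry of `φ` is zero or homogeneous of positive degree `b j - a i`
    (hφ : ∀ i j, φ i j = 0 ∨
      (0 < b j - a i ∧ (φ i j).IsHomogeneous (b j - a i).toNat))
    -- `I` is the ideal generated by the `n × n` minors of `φ`
    (I : Ideal (MvPolynomial (Fin 3) K))
    (hI : I = Ideal.span {m | ∃ g : Fin n → Fin (n + 2),
        Function.Injective g ∧ m = (φ.submatrix id g).det})
    -- `I` has codimension `3`
    (hht : idealHeight I = 3) :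
    ∀ i : Fin n, a i < b (Fin.castLE (by omega) i) := by
  intro k
  by_contra! hk
  obtain ⟨m, hm⟩ : ∃ m, n = k + (m + 1) := ⟨n - k - 1, by omega⟩
  let r : Fin (m + 1) → Fin n := fun i => ⟨k + i, by omega⟩
  let c : Fin (m + 2) → Fin (n + 2) := fun j => ⟨k + 1 + j, by omega⟩
  have hr : Function.Injective r := fun i i' h => by
    simp only [r, Fin.mk.injEq] at h
    omega
  have hzero (i : Fin (m + 1)) (j : Fin (n + 2)) (hj : (j : ℕ) ≤ k) : φ (r i) j = 0 := by
    refine (hφ (r i) j).resolve_right fun h => ?_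
    have h1 : b j ≤ b (Fin.castLE (by omega) k) := hb hj
    have h2 : a k ≤ a (r i) := ha (Fin.le_def.mpr (Nat.le_add_right _ _))
    linarith [h.1]
  let 𝔪 : Ideal (MvPolynomial (Fin 3) K) := RingHom.ker constantCoeff
  have h𝔪 : 𝔪.IsPrime := RingHom.ker_isPrime _
  have hmem (i j) : φ i j ∈ 𝔪 := by
    rcases hφ i j with h | ⟨hpos, hhom⟩
    · rw [h]
      exact 𝔪.zero_mem
    · rw [RingHom.mem_ker, constantCoeff_eq]
      refine hhom.coeff_eq_zero ?_
      simp
      omega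
  obtain ⟨P, hP, ⟨y, ⟨i, hi⟩, hy⟩, hht2⟩ :=
    Matrix.exists_height_le_two_rowsDependentMod (φ.submatrix r c) (𝔪 := 𝔪) fun i j => hmem _ _
  have hdep : φ.RowsDependentMod P := by
    refine ⟨Function.extend r y 0, ⟨r i, by rwa [hr.extend_apply]⟩, fun j => ?_⟩
    have hsum : ∑ i, Function.extend r y 0 i * φ i j = ∑ i, y i * φ (r i) j := by
      symm
      refine Finset.sum_of_injOn r hr.injOn (by simp) ?_ fun i _ => by rw [hr.extend_apply]
      intro i _ hir
      rw [Function.extend_apply' _ _ _ (by simpa using hir), Pi.zero_apply, zero_mul]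
    rw [hsum]
    by_cases hj : (j : ℕ) ≤ k
    · simp [hzero _ j hj]
    · obtain ⟨j, rfl⟩ : ∃ j', c j' = j :=
        ⟨⟨j - (k + 1), by omega⟩, Fin.ext (by simp only [c]; omega)⟩
      exact hy j
  have hIP : I ≤ P := by
    rw [hI, Ideal.span_le]
    rintro _ ⟨g, -, rfl⟩
    obtain ⟨z, hz, hz'⟩ := hdep
    exact Matrix.RowsDependentMod.det_mem ⟨z, hz, fun j => hz' (g j)⟩
  have hle : idealHeight I ≤ P.height := by
    rw [PrimeSpectrum.height_eq_orderHeight ⟨P, hP⟩]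
    exact iInf₂_le (⟨P, hP⟩ : PrimeSpectrum _) hIP
  rw [hht] at hle
  exact absurd (hle.trans hht2) (by decide)
end

section
/- For every j ∈ {1,…,n+2} there exists r ∈ {1,…,n+2} with r ≠ j such that the n×n minor Φ_{rj} of φ obtained by deleting columns r and j is nonzero. -/
open MvPolynomial

open scoped Matrix

/-- If `f` divides every entry of `v ᵥ* M` and the entries of `v` have no common factor, then `f`
divides `det M`. -/
theorem dvd_det_of_dvd_vecMul {R m : Type*} [CommRing R] [IsDomain R] [NormalizedGCDMonoid R]
    [Fintype m] [DecidableEq m] {v : m → R} (hv : Finset.univ.gcd v = 1) {M : Matrix m m R} {f : R}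
    (hf : ∀ k, f ∣ (v ᵥ* M) k) : f ∣ M.det := by
  have key : ∀ i, f ∣ M.det * v i := fun i => by
    have h : ((v ᵥ* M) ᵥ* M.adjugate) i = M.det * v i := by
      rw [Matrix.vecMul_vecMul, Matrix.mul_adjugate]
      simp [Matrix.vecMul_smul]
    rw [← h]
    exact Finset.dvd_sum fun k _ => (hf k).mul_right _
  have hdvd := (Finset.gcd_mul_left' (s := Finset.univ) (f := v) M.det).dvd
  rw [hv, mul_one] at hdvd
  exact (Finset.dvd_gcd fun i _ => key i).trans hdvd

/-- A matrix over a domain whose rows satisfy no nontrivial linear relation has a nonzero maximal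
minor. -/
theorem exists_det_submatrix_ne_zero {R : Type*} [CommRing R] [IsDomain R] {n : ℕ} {ι : Type*}
    [Fintype ι] (A : Matrix (Fin n) ι R) (hA : ∀ v, v ᵥ* A = 0 → v = 0) :
    ∃ g : Fin n → ι, Function.Injective g ∧ (A.submatrix id g).det ≠ 0 := by
  let F := FractionRing R
  let B : Matrix (Fin n) ι F := A.map (algebraMap R F)
  have hinj : Function.Injective (algebraMap R F) := IsFractionRing.injective R F
  have hrow : LinearIndependent F B.row := by
    rw [← LinearIndependent.iff_fractionRing R F, Fintype.linearIndependent_iff]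
    intro v hv
    refine fun i => congrFun (hA v ?_) i
    ext k
    apply hinj
    have := congrFun hv k
    simpa [B, Matrix.vecMul, dotProduct, Algebra.smul_def, Finset.sum_apply] using this
  obtain ⟨κ, c, hc, hspan, hli⟩ := exists_linearIndependent' F B.col
  have : Finite κ := Finite.of_injective c hc
  have := Fintype.ofFinite κ
  have hcard : Fintype.card κ = n := by
    rw [← finrank_span_eq_card hli, hspan, ← Matrix.rank_eq_finrank_span_cols, hrow.rank_matrix,
      Fintype.card_fin]
  let e : Fin n ≃ κ := (Fintype.equivFinOfCardEq hcard).symm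
  refine ⟨c ∘ e, hc.comp e.injective, fun h => ?_⟩
  have hli' : LinearIndependent F (B.submatrix id (c ∘ e)).col := hli.comp e e.injective
  rw [Matrix.linearIndependent_cols_iff_isUnit, Matrix.isUnit_iff_isUnit_det,
    isUnit_iff_ne_zero] at hli'
  apply hli'
  have : B.submatrix id (c ∘ e) = (algebraMap R F).mapMatrix (A.submatrix id (c ∘ e)) := rfl
  rw [this, ← RingHom.map_det, h, map_zero]

/-- A maximal minor is nonzero if some nonzero maximal minor uses only the same columns. -/
theorem det_submatrix_ne_zero_of_range_subset {R : Type*} [CommRing R] {n : ℕ} {ι : Type*}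
    {A : Matrix (Fin n) ι R} {g h : Fin n → ι} (hh : Function.Injective h)
    (hr : Set.range h ⊆ Set.range g) (hd : (A.submatrix id h).det ≠ 0) :
    (A.submatrix id g).det ≠ 0 := by
  choose σ hσ using fun k => hr (Set.mem_range_self k)
  have hσi : Function.Injective σ := fun x y hxy => hh (by rw [← hσ x, ← hσ y, hxy])
  let τ : Equiv.Perm (Fin n) := Equiv.ofBijective σ (Finite.injective_iff_bijective.1 hσi)
  have heq : h = g ∘ τ := funext fun k => (hσ k).symm
  intro h0
  apply hd
  have := Matrix.det_permute' τ (A.submatrix id g)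
  rw [Matrix.submatrix_submatrix, h0, mul_zero] at this
  rw [heq]
  exact this

/-- An ideal contained in a proper principal ideal of a Noetherian ring has height at most one. -/
theorem idealHeight_le_one {R : Type*} [CommRing R] [IsNoetherianRing R] {I : Ideal R} {f : R}
    (hf : ¬ IsUnit f) (hI : I ≤ Ideal.span {f}) : idealHeight I ≤ 1 := by
  obtain ⟨p, hp⟩ := Ideal.nonempty_minimalPrimes (I := Ideal.span {f})
    (by rwa [Ne, Ideal.span_singleton_eq_top])
  have hprime : p.IsPrime := hp.1.1
  have h1 := Ideal.height_le_one_of_isPrincipal_of_mem_minimalPrimes _ p hp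
  refine (iInf₂_le (⟨p, hprime⟩ : PrimeSpectrum R) (hI.trans hp.1.2)).trans ?_
  rwa [← PrimeSpectrum.height_eq_orderHeight]

/-- For every column index `j` there is an `r ≠ j` such that the
`n × n` minor of `φ` obtained by deleting columns `r` and `j` is nonzero. -/
theorem stmt3 {K : Type*} [Field K] [IsAlgClosed K]
    (n : ℕ) (hn : 0 < n) (a : Fin n → ℤ) (b : Fin (n + 2) → ℤ)
    (ha : Monotone a) (hb : Monotone b)
    (φ : Matrix (Fin n) (Fin (n + 2)) (MvPolynomial (Fin 3) K))
    (hφ : ∀ i j, φ i j = 0 ∨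
      (0 < b j - a i ∧ (φ i j).IsHomogeneous (b j - a i).toNat))
    (I : Ideal (MvPolynomial (Fin 3) K))
    (hI : I = Ideal.span {m | ∃ g : Fin n → Fin (n + 2),
        Function.Injective g ∧ m = (φ.submatrix id g).det})
    (hht : idealHeight I = 3) :
    ∀ j : Fin (n + 2), ∃ r : Fin (n + 2), r ≠ j ∧
      ∀ g : Fin n → Fin (n + 2), Function.Injective g →
        Set.range g = ({r, j} : Set (Fin (n + 2)))ᶜ →
        (φ.submatrix id g).det ≠ 0 := by
  intro j
  let A := φ.submatrix id j.succAbove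
  have hA : ∀ v, v ᵥ* A = 0 → v = 0 := by
    by_contra! hcon
    obtain ⟨v, hv, hv0⟩ := hcon
    have : Nonempty (Fin n) := ⟨⟨0, hn⟩⟩
    let : StrongNormalizationMonoid (MvPolynomial (Fin 3) K) :=
      UniqueFactorizationMonoid.strongNormalizationMonoid
    let : NormalizedGCDMonoid (MvPolynomial (Fin 3) K) :=
      UniqueFactorizationMonoid.toNormalizedGCDMonoid _
    obtain ⟨w, hw, hw1⟩ := Finset.extract_gcd v (Finset.univ_nonempty)
    have hd : Finset.univ.gcd v ≠ 0 := fun h => hv0 <| funext fun i => by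
      rw [hw i (Finset.mem_univ i), h, zero_mul, Pi.zero_apply]
    have hvw : v = Finset.univ.gcd v • w := funext fun i => hw i (Finset.mem_univ i)
    have hwA : w ᵥ* A = 0 := by
      rw [hvw, Matrix.smul_vecMul] at hv
      exact (smul_eq_zero.1 hv).resolve_left hd
    let f := (w ᵥ* φ) j
    have hfdvd : ∀ k, f ∣ (w ᵥ* φ) k := fun k => by
      rcases eq_or_ne k j with rfl | hk
      · exact dvd_rfl
      · obtain ⟨l, rfl⟩ := Fin.exists_succAbove_eq hk
        have : (w ᵥ* φ) (j.succAbove l) = 0 := congrFun hwA l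
        simp [this]
    have hcoeff : ∀ i k, constantCoeff (φ i k) = 0 := fun i k => by
      rcases hφ i k with h | ⟨hpos, h⟩
      · rw [h, map_zero]
      · rw [constantCoeff_eq]
        exact h.coeff_eq_zero (by simp; omega)
    have hf : ¬ IsUnit f := fun hu => by
      have := hu.map (constantCoeff (R := K) (σ := Fin 3))
      simp [f, Matrix.vecMul, dotProduct, hcoeff] at this
    have hIf : I ≤ Ideal.span {f} := by
      rw [hI, Ideal.span_le]
      rintro _ ⟨g, -, rfl⟩
      exact Ideal.mem_span_singleton.2 (dvd_det_of_dvd_vecMul hw1 fun k => hfdvd (g k))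
    have := idealHeight_le_one hf hIf
    rw [hht] at this
    exact absurd this (by norm_num)
  obtain ⟨g₀, hg₀, hdet⟩ := exists_det_submatrix_ne_zero A hA
  obtain ⟨r, hr⟩ : ∃ r, r ∉ Set.range g₀ := by
    by_contra! hsurj
    have := Fintype.card_le_of_surjective g₀ hsurj
    simp at this
  refine ⟨j.succAbove r, Fin.succAbove_ne j r, fun g _ hrange => ?_⟩
  refine det_submatrix_ne_zero_of_range_subset (h := j.succAbove ∘ g₀)
    (Fin.succAbove_right_injective.comp hg₀) ?_ hdet
  rw [hrange]
  rintro _ ⟨k, rfl⟩ (h | h)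
  · exact hr ⟨k, Fin.succAbove_right_injective h⟩
  · exact Fin.succAbove_ne _ _ h
end

section
/- Let K be an algebraically closed field of characteristic zero and R = K[x,y,z]. If f_1, f_2, f_3 is a regular sequence of homogeneous polynomials of positive degree in R and I = (f_1, f_2, f_3), then the Artinian algebra R/I has the Weak Lefschetz Property. -/
open MvPolynomial

noncomputable section

/-- The degree-`z` homogeneous component of `K[x₁, …, x_r]`, for `z : ℤ`
(it is zero in negative degrees). -/
def hcomp (K : Type*) [Field K] (r : ℕ) (z : ℤ) : Submodule K (MvPolynomial (Fin r) K) :=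
  if 0 ≤ z then homogeneousSubmodule (Fin r) K z.toNat else ⊥

/-- The degree-`t` graded piece of the quotient `R ⧸ I` of the (standardly graded)
polynomial ring by a homogeneous ideal: the image of the degree-`t` piece of `R`. -/
def quotPiece {K : Type*} [Field K] {r : ℕ} (I : Ideal (MvPolynomial (Fin r) K)) (t : ℤ) :
    Submodule K (MvPolynomial (Fin r) K ⧸ I) :=
  (hcomp K r t).map (I.mkQ.restrictScalars K)

end

theorem supportDim_add_length_le_of_isWeaklyRegular {R : Type*} [CommRing R] [IsNoetherianRing R]
    {M : Type*} [AddCommGroup M] [Module R M] [Module.Finite R M] (rs : List R)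
    (reg : RingTheory.Sequence.IsWeaklyRegular M rs) :
    Module.supportDim R (M ⧸ Ideal.ofList rs • (⊤ : Submodule R M)) + rs.length ≤
      Module.supportDim R M := by
  induction rs generalizing M with
  | nil =>
    rw [Ideal.ofList_nil, Submodule.bot_smul]
    simpa using (Module.supportDim_eq_of_equiv (Submodule.quotEquivOfEqBot ⊥ rfl)).le
  | cons x rs' ih =>
    obtain ⟨h1, h2⟩ := (RingTheory.Sequence.isWeaklyRegular_cons_iff M _ _).mp reg
    have h3 := ih h2
    have h4 := Module.supportDim_quotSMulTop_succ_le_of_notMem_minimalPrimes (M := M) (x := x)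
      (fun _ ↦ h1.notMem_of_mem_minimalPrimes)
    rw [Module.supportDim_eq_of_equiv (Submodule.quotOfListConsSMulTopEquivQuotSMulTopInner M x _)]
    refine le_trans ?_ h4
    simp only [List.length_cons, Nat.cast_add, Nat.cast_one, ← add_assoc]
    gcongr

theorem MvPolynomial.isMaximal_of_isWeaklyRegular {K : Type*} [Field K] {n : ℕ}
    (rs : List (MvPolynomial (Fin n) K)) (hlen : rs.length = n)
    (reg : RingTheory.Sequence.IsWeaklyRegular (MvPolynomial (Fin n) K) rs)
    (P : Ideal (MvPolynomial (Fin n) K)) [hP : P.IsPrime] (hI : Ideal.ofList rs ≤ P) :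
    P.IsMaximal := by
  have h := supportDim_add_length_le_of_isWeaklyRegular rs reg
  have eq : Ideal.ofList rs = Ideal.ofList rs • (⊤ : Ideal (MvPolynomial (Fin n) K)) := by simp
  rw [Module.supportDim_self_eq_ringKrullDim, MvPolynomial.ringKrullDim_of_isNoetherianRing,
    ringKrullDim_eq_zero_of_field, hlen] at h
  have h0 : Module.supportDim (MvPolynomial (Fin n) K)
    (MvPolynomial (Fin n) K ⧸ (Ideal.ofList rs • ⊤ : Ideal (MvPolynomial (Fin n) K))) =
      ringKrullDim (MvPolynomial (Fin n) K ⧸ Ideal.ofList rs) := by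
    rw [Module.supportDim_quotient_eq_ringKrullDim, ← eq]
  rw [h0] at h
  have h1 : ringKrullDim (MvPolynomial (Fin n) K ⧸ Ideal.ofList rs) ≤ 0 := by
    simp only [Nat.card_eq_fintype_card, Fintype.card_fin] at h
    generalize ringKrullDim (MvPolynomial (Fin n) K ⧸ Ideal.ofList rs) = d at h
    induction d with
    | bot => simp
    | coe d =>
      norm_cast at h ⊢
      induction d with
      | top => simp at h
      | coe d => norm_cast at h ⊢; omega
  have : Ring.KrullDimLE 0 (MvPolynomial (Fin n) K ⧸ Ideal.ofList rs) :=
    Order.krullDimLE_iff _ _ |>.2 (by exact_mod_cast h1)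
  have hp : (P.map (Ideal.Quotient.mk (Ideal.ofList rs))).IsPrime :=
    Ideal.map_isPrime_of_surjective Ideal.Quotient.mk_surjective (by simpa using hI)
  have hm := hp.isMaximal'
  have := Ideal.comap_isMaximal_of_surjective (Ideal.Quotient.mk (Ideal.ofList rs))
    Ideal.Quotient.mk_surjective (K := P.map (Ideal.Quotient.mk (Ideal.ofList rs)))
  rwa [Ideal.comap_map_of_surjective _ Ideal.Quotient.mk_surjective, ← RingHom.ker_eq_comap_bot,
    Ideal.mk_ker, sup_eq_left.2 hI] at this

theorem MvPolynomial.exists_X_pow_mem_of_isWeaklyRegular {K : Type*} [Field K] [IsAlgClosed K]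
    {n : ℕ} (rs : List (MvPolynomial (Fin n) K)) (hlen : rs.length = n)
    (reg : RingTheory.Sequence.IsWeaklyRegular (MvPolynomial (Fin n) K) rs)
    (hom : ∀ f ∈ rs, ∃ e : ℕ, 0 < e ∧ f.IsHomogeneous e) :
    ∃ N : ℕ, ∀ i, (X i : MvPolynomial (Fin n) K) ^ N ∈ Ideal.ofList rs := by
  have hz : ∀ i, (X i : MvPolynomial (Fin n) K) ∈ (Ideal.ofList rs).radical := by
    intro i
    rw [← MvPolynomial.vanishingIdeal_zeroLocus_eq_radical (K := K), mem_vanishingIdeal_iff]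
    intro x hx
    by_contra hxi
    replace hxi : x i ≠ 0 := by simpa using hxi
    set φ : MvPolynomial (Fin n) K →ₐ[K] Polynomial K :=
      aeval fun j ↦ Polynomial.C (x j) * Polynomial.X with hφ
    have hle : Ideal.ofList rs ≤ RingHom.ker φ := by
      rw [Ideal.ofList, Ideal.span_le]
      intro f hf
      obtain ⟨e, he, hfe⟩ := hom f hf
      have h0 := hx f (Ideal.subset_span hf)
      rw [SetLike.mem_coe, RingHom.mem_ker, hφ, aeval_def, eval₂_eq]
      rw [aeval_def, eval₂_eq] at h0
      have : ∀ d ∈ f.support, (algebraMap K (Polynomial K)) (coeff d f) *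
          ∏ i ∈ d.support, (Polynomial.C (x i) * Polynomial.X) ^ d i =
          Polynomial.C (algebraMap K K (coeff d f) * ∏ i ∈ d.support, x i ^ d i) *
            Polynomial.X ^ e := by
        intro d hd
        simp only [mul_pow, Finset.prod_mul_distrib, Finset.prod_pow_eq_pow_sum]
        have : ∑ i ∈ d.support, d i = e := (hfe.degree_eq_sum_deg_support hd).symm
        rw [this]
        simp [Polynomial.algebraMap_eq, mul_assoc]
      rw [Finset.sum_congr rfl this, ← Finset.sum_mul, ← map_sum, h0]
      simp
    have : (RingHom.ker φ).IsPrime := RingHom.ker_isPrime φ.toRingHom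
    have hmax := MvPolynomial.isMaximal_of_isWeaklyRegular rs hlen reg (RingHom.ker φ) hle
    have hle2 : RingHom.ker φ ≤ RingHom.ker ((Polynomial.aeval (0 : K)).comp φ) := by
      intro p hp
      rw [RingHom.mem_ker] at hp ⊢
      simp [hp]
    have heq := hmax.eq_of_le (RingHom.ker_isPrime _).ne_top hle2
    have : (X i : MvPolynomial (Fin n) K) ∈ RingHom.ker φ := by
      rw [heq, RingHom.mem_ker]
      simp [hφ]
    rw [RingHom.mem_ker] at this
    simp [hφ, hxi] at this
  choose m hm using hz
  refine ⟨∑ i, m i, fun i ↦ ?_⟩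
  exact Ideal.pow_mem_of_pow_mem _ (hm i)
    (Finset.single_le_sum (f := m) (fun _ _ ↦ Nat.zero_le _) (Finset.mem_univ i))

noncomputable section

/-- The polynomials all of whose monomials have total degree `z`, for an integer `z`. -/
def homZ (A σ : Type*) [CommRing A] (z : ℤ) : Submodule A (MvPolynomial σ A) where
  carrier := {p | ∀ d, coeff d p ≠ 0 → (d.degree : ℤ) = z}
  add_mem' {p q} hp hq d hd := by
    by_cases h : coeff d p = 0
    · exact hq d (by simpa [h] using hd)
    · exact hp d h
  zero_mem' d hd := by simp at hd
  smul_mem' c p hp d hd := hp d fun h ↦ hd (by simp [h])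

section homZ

variable {A B σ : Type*} [CommRing A] [CommRing B]

theorem mem_homZ {z : ℤ} {p : MvPolynomial σ A} :
    p ∈ homZ A σ z ↔ ∀ d, coeff d p ≠ 0 → (d.degree : ℤ) = z := Iff.rfl

theorem mem_homZ_natCast {n : ℕ} {p : MvPolynomial σ A} :
    p ∈ homZ A σ n ↔ p.IsHomogeneous n := by
  rw [mem_homZ]
  constructor
  · intro h d hd
    have := h d hd
    rw [Finsupp.degree_eq_weight_one] at this
    exact_mod_cast this
  · intro h d hd
    by_contra hne
    exact hd (h.coeff_eq_zero (by exact_mod_cast hne))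

theorem eq_zero_of_mem_homZ_of_neg {z : ℤ} (hz : z < 0) {p : MvPolynomial σ A}
    (hp : p ∈ homZ A σ z) : p = 0 := by
  ext d
  by_contra h
  have := hp d (by simpa using h)
  omega

theorem nonneg_of_mem_homZ {z : ℤ} {p : MvPolynomial σ A} (hp : p ≠ 0)
    (h1 : p ∈ homZ A σ z) : 0 ≤ z := by
  by_contra h
  exact hp (eq_zero_of_mem_homZ_of_neg (by omega) h1)

theorem mul_mem_homZ {z w : ℤ} {p q : MvPolynomial σ A} (hp : p ∈ homZ A σ z)
    (hq : q ∈ homZ A σ w) : p * q ∈ homZ A σ (z + w) := by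
  classical
  intro d hd
  rw [coeff_mul] at hd
  obtain ⟨⟨i, j⟩, hij, h⟩ := Finset.exists_ne_zero_of_sum_ne_zero hd
  rw [Finset.HasAntidiagonal.mem_antidiagonal] at hij
  rw [← hp i (left_ne_zero_of_mul h), ← hq j (right_ne_zero_of_mul h), ← hij]
  simp

theorem C_mem_homZ (a : A) : (C a : MvPolynomial σ A) ∈ homZ A σ 0 := by
  have := mem_homZ_natCast.2 (isHomogeneous_C σ a)
  exact_mod_cast this

theorem X_mem_homZ (i : σ) : (X i : MvPolynomial σ A) ∈ homZ A σ 1 := by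
  have := mem_homZ_natCast.2 (isHomogeneous_X A i)
  exact_mod_cast this

theorem C_mul_mem_homZ {z : ℤ} (a : A) {p : MvPolynomial σ A} (hp : p ∈ homZ A σ z) :
    C a * p ∈ homZ A σ z := by
  rw [C_mul']; exact Submodule.smul_mem _ _ hp

theorem map_mem_homZ {z : ℤ} (φ : A →+* B) {p : MvPolynomial σ A} (hp : p ∈ homZ A σ z) :
    map φ p ∈ homZ B σ z := by
  intro d hd
  rw [coeff_map] at hd
  exact hp d fun h ↦ hd (by simp [h])

theorem mem_homZ_of_map {z : ℤ} {φ : A →+* B} (hφ : Function.Injective φ) {p : MvPolynomial σ A}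
    (hp : map φ p ∈ homZ B σ z) : p ∈ homZ A σ z := by
  intro d hd
  exact hp d (by rw [coeff_map]; simpa [map_eq_zero_iff φ hφ] using hd)

theorem mem_homZ_zero {p : MvPolynomial σ A} (hp : p ∈ homZ A σ 0) : ∃ a, p = C a := by
  have : p.IsHomogeneous 0 := mem_homZ_natCast.1 (by exact_mod_cast hp)
  exact ⟨_, totalDegree_eq_zero_iff_eq_C.1 ((totalDegree_zero_iff_isHomogeneous σ).2 this)⟩

/-- The homogeneous component of integer degree `z`. -/
def compZ (z : ℤ) : MvPolynomial σ A →ₗ[A] MvPolynomial σ A :=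
  if 0 ≤ z then homogeneousComponent z.toNat else 0

theorem compZ_mem (z : ℤ) (p : MvPolynomial σ A) : compZ z p ∈ homZ A σ z := by
  rw [compZ]
  split_ifs with h
  · lift z to ℕ using h
    exact mem_homZ_natCast.2 (homogeneousComponent_isHomogeneous _ _)
  · exact zero_mem _

theorem compZ_of_mem {z w : ℤ} {p : MvPolynomial σ A} (hp : p ∈ homZ A σ w) :
    compZ z p = if w = z then p else 0 := by
  by_cases hp0 : p = 0
  · simp [hp0]
  have hw := nonneg_of_mem_homZ hp0 hp
  lift w to ℕ using hw
  rw [compZ]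
  split_ifs with h h1 h1
  · subst h1
    simp only [Int.toNat_natCast]
    exact homogeneousComponent_eq_self (mem_homZ_natCast.1 hp)
  · lift z to ℕ using h
    simp only [Int.toNat_natCast]
    rw [homogeneousComponent_of_mem (mem_homZ_natCast.1 hp), if_neg]
    rintro rfl; exact h1 rfl
  · omega
  · rfl

theorem compZ_mul {z w : ℤ} (e : MvPolynomial σ A) {q : MvPolynomial σ A} (hq : q ∈ homZ A σ w) :
    compZ z (e * q) = compZ (z - w) e * q := by
  have key : ∀ i : ℕ, compZ z (homogeneousComponent i e * q) =
      compZ (z - w) (homogeneousComponent i e) * q := by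
    intro i
    have h1 := mem_homZ_natCast.2 (homogeneousComponent_isHomogeneous i e)
    rw [compZ_of_mem (mul_mem_homZ h1 hq), compZ_of_mem h1]
    split_ifs
    · rfl
    · omega
    · omega
    · simp
  rw [← sum_homogeneousComponent e, Finset.sum_mul, map_sum, map_sum, Finset.sum_mul]
  exact Finset.sum_congr rfl fun i _ ↦ key i

theorem mem_homZ_of_mul_right [IsDomain A] {z w : ℤ} {e q : MvPolynomial σ A}
    (hq : q ∈ homZ A σ w) (hq0 : q ≠ 0) (h : e * q ∈ homZ A σ z) : e ∈ homZ A σ (z - w) := by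
  have h1 := compZ_mul (z := z) e hq
  rw [compZ_of_mem h, if_pos rfl] at h1
  rw [mul_right_cancel₀ hq0 h1]
  exact compZ_mem _ _

theorem mem_homZ_totalDegree_of_mul [IsDomain A] {z : ℤ} {p q : MvPolynomial σ A}
    (hpq : p * q ≠ 0) (h : p * q ∈ homZ A σ z) : p ∈ homZ A σ p.totalDegree := by
  have hz := nonneg_of_mem_homZ hpq h
  lift z to ℕ using hz
  have h1 := (mem_homZ_natCast.1 h).totalDegree hpq
  rw [totalDegree_mul_of_isDomain (left_ne_zero_of_mul hpq) (right_ne_zero_of_mul hpq)] at h1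
  have lo : ∀ r : MvPolynomial σ A, r ≠ 0 → (r : MvPowerSeries σ A).order ≤ r.totalDegree := by
    intro r hr
    obtain ⟨d, hd⟩ := MvPolynomial.ne_zero_iff.1 hr
    refine (MvPowerSeries.order_le (d := d) (by simpa using hd)).trans ?_
    exact_mod_cast le_totalDegree (mem_support_iff.2 hd)
  have h2 : (z : ℕ∞) ≤ ((p * q : MvPolynomial σ A) : MvPowerSeries σ A).order := by
    refine MvPowerSeries.le_order fun d hd ↦ ?_
    by_contra hne
    have := h d (by rwa [← coeff_coe])
    have h3 : d.degree = z := by exact_mod_cast this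
    simp [h3] at hd
  rw [coe_mul, MvPowerSeries.order_mul] at h2
  have hp1 := lo p (left_ne_zero_of_mul hpq)
  have hq1 := lo q (right_ne_zero_of_mul hpq)
  have h3 : (p.totalDegree : ℕ∞) ≤ (p : MvPowerSeries σ A).order := by
    generalize (p : MvPowerSeries σ A).order = x at *
    generalize (q : MvPowerSeries σ A).order = y at *
    lift x to ℕ using ne_top_of_le_ne_top (by simp) hp1
    lift y to ℕ using ne_top_of_le_ne_top (by simp) hq1
    norm_cast at *
    omega
  intro d hd
  have h4 := h3.trans (MvPowerSeries.order_le (f := (p : MvPowerSeries σ A)) (d := d)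
    (by simpa using hd))
  have h5 := le_totalDegree (mem_support_iff.2 hd)
  have h6 : p.totalDegree ≤ d.degree := by exact_mod_cast h4
  have h7 : d.degree ≤ p.totalDegree := h5
  omega

end homZ

theorem finrank_homZ_aux (k : Type*) [Field k] (z : ℤ) :
    Module.Finite k (homZ k (Fin 2) z) ∧
      Module.finrank k (homZ k (Fin 2) z) = (z + 1).toNat := by
  rcases lt_or_ge z 0 with hz | hz
  · have : homZ k (Fin 2) z = ⊥ :=
      (Submodule.eq_bot_iff _).2 fun p hp ↦ eq_zero_of_mem_homZ_of_neg hz hp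
    rw [this]
    refine ⟨inferInstance, ?_⟩
    rw [finrank_bot]
    omega
  · lift z to ℕ using hz
    have h : homZ k (Fin 2) z = Submodule.span k
        (Set.range fun i : Fin (z + 1) ↦
          (X 0 ^ (i : ℕ) * X 1 ^ (z - i : ℕ) : MvPolynomial (Fin 2) k)) := by
      apply le_antisymm
      · intro p hp
        rw [p.as_sum]
        refine Submodule.sum_mem _ fun d hd ↦ ?_
        have hd' := hp d (mem_support_iff.1 hd)
        have hd2 : d 0 + d 1 = z := by
          rw [Finsupp.degree_eq_sum] at hd'
          simpa [Fin.sum_univ_two] using (by exact_mod_cast hd' : ∑ i, d i = z)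
        have : monomial d (coeff d p) = coeff d p •
            (X 0 ^ (d 0) * X 1 ^ (z - d 0) : MvPolynomial (Fin 2) k) := by
          rw [monomial_eq, Finsupp.prod_fintype _ _ (by simp), Fin.prod_univ_two, ← hd2,
            Nat.add_sub_cancel_left, smul_eq_C_mul]
        rw [this]
        exact Submodule.smul_mem _ _ (Submodule.subset_span ⟨⟨d 0, by omega⟩, rfl⟩)
      · rw [Submodule.span_le]
        rintro _ ⟨i, rfl⟩
        refine mem_homZ_natCast.2 ?_
        have := ((isHomogeneous_X_pow (R := k) (0 : Fin 2) (i : ℕ))).mul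
          (isHomogeneous_X_pow (R := k) (1 : Fin 2) (z - i : ℕ))
        rwa [show (i : ℕ) + (z - i) = z by omega] at this
    have hli : LinearIndependent k (fun i : Fin (z + 1) ↦
          (X 0 ^ (i : ℕ) * X 1 ^ (z - i : ℕ) : MvPolynomial (Fin 2) k)) := by
      have e : (fun i : Fin (z + 1) ↦
          (X 0 ^ (i : ℕ) * X 1 ^ (z - i : ℕ) : MvPolynomial (Fin 2) k)) =
          basisMonomials (Fin 2) k ∘
            fun i : Fin (z + 1) ↦ Finsupp.single 0 (i : ℕ) + Finsupp.single 1 (z - i : ℕ) := by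
        funext i
        simp only [Function.comp, coe_basisMonomials]
        rw [monomial_eq, Finsupp.prod_fintype _ _ (by simp), Fin.prod_univ_two]
        simp
      rw [e]
      exact (basisMonomials (Fin 2) k).linearIndependent.comp _ fun i j hij ↦ by
        have := DFunLike.congr_fun hij 0
        simp at this
        exact Fin.ext this
    rw [h]
    refine ⟨Module.Finite.span_of_finite k (Set.finite_range _), ?_⟩
    rw [finrank_span_eq_card hli]
    simp

instance (k : Type*) [Field k] (z : ℤ) : Module.Finite k (homZ k (Fin 2) z) :=
  (finrank_homZ_aux k z).1

theorem finrank_homZ (k : Type*) [Field k] (z : ℤ) :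
    Module.finrank k (homZ k (Fin 2) z) = (z + 1).toNat :=
  (finrank_homZ_aux k z).2

end

noncomputable section

/-- A triple without common non-unit divisor. -/
def IsPrimitiveTriple {T : Type*} [CommRing T] (g : Fin 3 → T) : Prop :=
  ∀ d, (∀ i, d ∣ g i) → IsUnit d

section Triples

variable {T : Type*} [CommRing T]

theorem IsPrimitiveTriple.exists_ne_zero [IsDomain T] {g : Fin 3 → T} (hg : IsPrimitiveTriple g) :
    ∃ i, g i ≠ 0 := by
  by_contra! h
  exact not_isUnit_zero (hg 0 fun i ↦ by simp [h])

theorem exists_eq_mul_isPrimitiveTriple [IsDomain T] [UniqueFactorizationMonoid T]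
    (g : Fin 3 → T) :
    ∃ d q, (∀ i, g i = d * q i) ∧ IsPrimitiveTriple q := by
  classical
  let : StrongNormalizationMonoid T := UniqueFactorizationMonoid.strongNormalizationMonoid
  let : NormalizedGCDMonoid T := UniqueFactorizationMonoid.toNormalizedGCDMonoid T
  obtain ⟨q, h1, h2⟩ := Finset.extract_gcd (s := Finset.univ) g Finset.univ_nonempty
  refine ⟨_, q, fun i ↦ h1 i (Finset.mem_univ i), fun d hd ↦ ?_⟩
  exact isUnit_iff_dvd_one.2 (h2 ▸ Finset.dvd_gcd fun i _ ↦ hd i)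

theorem IsPrimitiveTriple.dvd_of_forall_dvd_mul [IsDomain T] [UniqueFactorizationMonoid T]
    {g : Fin 3 → T} (hg : IsPrimitiveTriple g) {d c : T}
    (h : ∀ i, d ∣ c * g i) : d ∣ c := by
  classical
  let : StrongNormalizationMonoid T := UniqueFactorizationMonoid.strongNormalizationMonoid
  let : NormalizedGCDMonoid T := UniqueFactorizationMonoid.toNormalizedGCDMonoid T
  have hunit : IsUnit (Finset.univ.gcd g) := hg _ fun i ↦ Finset.gcd_dvd (Finset.mem_univ i)
  have h1 : d ∣ Finset.univ.gcd fun i ↦ c * g i := Finset.dvd_gcd fun i _ ↦ h i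
  exact hunit.dvd_mul_right.1 (h1.trans (Finset.gcd_mul_left' ..).dvd)

theorem IsPrimitiveTriple.exists_eq_mul [IsDomain T] [UniqueFactorizationMonoid T]
    {g v : Fin 3 → T} (hg : IsPrimitiveTriple g) (h : ∀ i j, v i * g j = v j * g i) :
    ∃ e, ∀ i, v i = e * g i := by
  obtain ⟨j, hj⟩ := hg.exists_ne_zero
  obtain ⟨e, he⟩ : g j ∣ v j :=
    hg.dvd_of_forall_dvd_mul fun i ↦ ⟨v i, by rw [← h i j, mul_comm]⟩
  refine ⟨e, fun i ↦ mul_right_cancel₀ hj ?_⟩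
  rw [h i j, he]
  ring

theorem crossProduct_eq_zero_iff {g h : Fin 3 → T} :
    crossProduct g h = 0 ↔ ∀ i j, g i * h j = g j * h i := by
  rw [cross_apply]
  constructor
  · intro H
    have h0 := congrFun H 0
    have h1 := congrFun H 1
    have h2 := congrFun H 2
    simp [sub_eq_zero] at h0 h1 h2
    intro i j
    fin_cases i <;> fin_cases j <;> simp [h0, h1, h2]
  · intro H
    ext i
    fin_cases i <;> simp [H 1 2, H 2 0, H 0 1]

theorem crossProduct_parallel {g h f : Fin 3 → T} (hg : ∑ i, g i * f i = 0)
    (hh : ∑ i, h i * f i = 0) (i j : Fin 3) :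
    crossProduct g h i * f j = crossProduct g h j * f i := by
  rw [Fin.sum_univ_three] at hg hh
  rw [cross_apply]
  fin_cases i <;> fin_cases j <;> simp
  · linear_combination h 2 * hg - g 2 * hh
  · linear_combination g 1 * hh - h 1 * hg
  · linear_combination g 2 * hh - h 2 * hg
  · linear_combination h 0 * hg - g 0 * hh
  · linear_combination h 1 * hg - g 1 * hh
  · linear_combination g 0 * hh - h 0 * hg

end Triples

section Syzygies

variable {A σ : Type*} [CommRing A]

/-- Homogeneous syzygies, of total degree `t`, of three forms of degrees `d`. -/
def syzZ (f : Fin 3 → MvPolynomial σ A) (d : Fin 3 → ℕ) (t : ℤ) :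
    Submodule A (Fin 3 → MvPolynomial σ A) where
  carrier := {g | (∀ i, g i ∈ homZ A σ (t - d i)) ∧ ∑ i, g i * f i = 0}
  add_mem' {g h} hg hh := ⟨fun i ↦ add_mem (hg.1 i) (hh.1 i), by
    simp [add_mul, Finset.sum_add_distrib, hg.2, hh.2]⟩
  zero_mem' := ⟨fun i ↦ zero_mem _, by simp⟩
  smul_mem' c g hg := ⟨fun i ↦ Submodule.smul_mem _ _ (hg.1 i), by
    simp [← Finset.smul_sum, hg.2]⟩

theorem nonneg_of_mem_syzZ {f : Fin 3 → MvPolynomial σ A} {d : Fin 3 → ℕ} {t : ℤ}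
    {g : Fin 3 → MvPolynomial σ A} (hg : g ∈ syzZ f d t) (h0 : g ≠ 0) : 0 ≤ t := by
  obtain ⟨i, hi⟩ := Function.ne_iff.1 h0
  have := nonneg_of_mem_homZ hi (hg.1 i)
  omega

theorem crossProduct_mem_homZ {d : Fin 3 → ℕ} {a b : ℤ} {g h : Fin 3 → MvPolynomial σ A}
    (hg : ∀ i, g i ∈ homZ A σ (a - d i)) (hh : ∀ i, h i ∈ homZ A σ (b - d i)) (i : Fin 3) :
    crossProduct g h i ∈ homZ A σ (a + b - ∑ j, (d j : ℤ) + d i) := by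
  rw [cross_apply, Fin.sum_univ_three]
  have key : ∀ i j k : Fin 3, (d i + d j + d k : ℤ) = d 0 + d 1 + d 2 →
      g i * h j - g j * h i ∈ homZ A σ (a + b - (d 0 + d 1 + d 2) + d k) := by
    intro i j k hijk
    have e1 : a + b - (d 0 + d 1 + d 2) + d k = (a - d i) + (b - d j) := by omega
    have e2 : a + b - (d 0 + d 1 + d 2) + d k = (a - d j) + (b - d i) := by omega
    refine sub_mem ?_ ?_
    · rw [e1]; exact mul_mem_homZ (hg i) (hh j)
    · rw [e2]; exact mul_mem_homZ (hg j) (hh i)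
  fin_cases i
  · exact key 1 2 0 (by omega)
  · exact key 2 0 1 (by omega)
  · exact key 0 1 2 (by omega)

variable [IsDomain A]

theorem crossProduct_eq_zero_of_lt {f : Fin 3 → MvPolynomial σ A} {d : Fin 3 → ℕ} {a b : ℤ}
    [UniqueFactorizationMonoid (MvPolynomial σ A)]
    (hf : ∀ i, f i ∈ homZ A σ (d i)) (hprim : IsPrimitiveTriple f)
    {g h : Fin 3 → MvPolynomial σ A} (hg : g ∈ syzZ f d a) (hh : h ∈ syzZ f d b)
    (hab : a + b < ∑ j, (d j : ℤ)) : crossProduct g h = 0 := by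
  obtain ⟨c, hc⟩ := hprim.exists_eq_mul (crossProduct_parallel hg.2 hh.2)
  obtain ⟨i, hi⟩ := hprim.exists_ne_zero
  have h1 := crossProduct_mem_homZ hg.1 hh.1 i
  rw [hc i] at h1
  have h2 := mem_homZ_of_mul_right (hf i) hi h1
  have h3 := eq_zero_of_mem_homZ_of_neg (by omega) h2
  ext1 j
  rw [hc, h3]; simp

end Syzygies

section Field

variable {k : Type*} [Field k]

theorem finrank_pi_homZ (d : Fin 3 → ℕ) (t : ℤ) :
    (∑ i, (t - d i + 1) : ℤ) ≤
      Module.finrank k ((i : Fin 3) → homZ k (Fin 2) (t - d i)) := by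
  rw [Module.finrank_pi_fintype]
  push_cast
  refine Finset.sum_le_sum fun i _ ↦ ?_
  rw [finrank_homZ]
  exact Int.self_le_toNat _

variable {f : Fin 3 → MvPolynomial (Fin 2) k} {d : Fin 3 → ℕ}

/-- The map `(p₀, p₁, p₂) ↦ p₀ f₀ + p₁ f₁ + p₂ f₂` in degree `t`. -/
def combZ (hf : ∀ i, f i ∈ homZ k (Fin 2) (d i)) (t : ℤ) :
    ((i : Fin 3) → homZ k (Fin 2) (t - d i)) →ₗ[k] homZ k (Fin 2) t where
  toFun p := ⟨∑ i, (p i : MvPolynomial (Fin 2) k) * f i, Submodule.sum_mem _ fun i _ ↦ by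
    simpa using mul_mem_homZ (p i).2 (hf i)⟩
  map_add' p q := by
    ext1
    simp [add_mul, Finset.sum_add_distrib]
  map_smul' c p := by
    ext1
    simp [Finset.smul_sum]

/-- The inclusion of the kernel of `combZ` in all triples. -/
def kerCombZIncl (hf : ∀ i, f i ∈ homZ k (Fin 2) (d i)) (t : ℤ) :
    LinearMap.ker (combZ hf t) →ₗ[k] (Fin 3 → MvPolynomial (Fin 2) k) :=
  LinearMap.pi fun i ↦ (homZ k (Fin 2) (t - d i)).subtype ∘ₗ LinearMap.proj i ∘ₗ Submodule.subtype _

theorem kerCombZIncl_injective (hf : ∀ i, f i ∈ homZ k (Fin 2) (d i)) (t : ℤ) :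
    Function.Injective (kerCombZIncl hf t) := by
  intro p q h
  ext i : 3
  exact congrFun h i

theorem range_kerCombZIncl (hf : ∀ i, f i ∈ homZ k (Fin 2) (d i)) (t : ℤ) :
    LinearMap.range (kerCombZIncl hf t) = syzZ f d t := by
  ext g
  constructor
  · rintro ⟨p, rfl⟩
    exact ⟨fun i ↦ (p.1 i).2, congrArg Subtype.val p.2⟩
  · intro hg
    exact ⟨⟨fun i ↦ ⟨g i, hg.1 i⟩, Subtype.ext hg.2⟩, rfl⟩

theorem finite_syzZ (hf : ∀ i, f i ∈ homZ k (Fin 2) (d i)) (t : ℤ) :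
    Module.Finite k (syzZ f d t) := by
  rw [← range_kerCombZIncl hf t]
  infer_instance

theorem finrank_syzZ_add_finrank_range (hf : ∀ i, f i ∈ homZ k (Fin 2) (d i)) (t : ℤ) :
    (∑ i, (t - d i + 1) : ℤ) ≤
      Module.finrank k (syzZ f d t) + Module.finrank k (LinearMap.range (combZ hf t)) := by
  refine (finrank_pi_homZ (k := k) d t).trans ?_
  rw [← LinearMap.finrank_range_add_finrank_ker (combZ hf t), ← range_kerCombZIncl hf t,
    LinearMap.finrank_range_of_inj (kerCombZIncl_injective hf t)]
  push_cast
  rw [add_comm]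

theorem le_finrank_syzZ (hf : ∀ i, f i ∈ homZ k (Fin 2) (d i)) {t : ℤ} (ht : -1 ≤ t) :
    (∑ i, (t - d i + 1) : ℤ) - (t + 1) ≤ Module.finrank k (syzZ f d t) := by
  have h1 := finrank_syzZ_add_finrank_range hf t
  have h2 := Submodule.finrank_le (LinearMap.range (combZ hf t))
  rw [finrank_homZ] at h2
  omega

theorem finrank_syzZ_le_of_forall_eq_mul (g : Fin 3 → MvPolynomial (Fin 2) k) {a t : ℤ}
    (hg : g ∈ syzZ f d a) (h0 : g ≠ 0)
    (h : ∀ p ∈ syzZ f d t, ∃ e, ∀ i, p i = e * g i) :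
    Module.finrank k (syzZ f d t) ≤ (t - a + 1).toNat := by
  let φ : homZ k (Fin 2) (t - a) →ₗ[k] (Fin 3 → MvPolynomial (Fin 2) k) :=
    LinearMap.pi fun i ↦ LinearMap.mulRight k (g i) ∘ₗ Submodule.subtype _
  have hle : syzZ f d t ≤ LinearMap.range φ := by
    intro p hp
    obtain ⟨e, he⟩ := h p hp
    obtain ⟨i, hi⟩ := Function.ne_iff.1 h0
    have h1 := hp.1 i
    rw [he i] at h1
    have h2 := mem_homZ_of_mul_right (hg.1 i) hi h1
    rw [show t - d i - (a - d i) = t - a by ring] at h2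
    exact ⟨⟨e, h2⟩, funext fun j ↦ (he j).symm⟩
  have h1 := Submodule.finrank_mono hle
  have h2 := LinearMap.finrank_range_le φ
  rw [finrank_homZ] at h2
  exact h1.trans h2

/-- Hilbert–Burch for three coprime binary forms. -/
theorem exists_syzygy_basis (hf : ∀ i, f i ∈ homZ k (Fin 2) (d i)) (hprim : IsPrimitiveTriple f) :
    ∃ (a b : ℤ) (g h : Fin 3 → MvPolynomial (Fin 2) k) (c : k), a ≤ b ∧
      a + b = ∑ i, (d i : ℤ) ∧ g ∈ syzZ f d a ∧ h ∈ syzZ f d b ∧ c ≠ 0 ∧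
      ∀ i, crossProduct g h i = C c * f i := by
  classical
  have hex : ∃ n : ℕ, ∃ g ∈ syzZ f d (n : ℤ), g ≠ 0 := by
    refine ⟨∑ i, d i, ?_⟩
    have h1 := le_finrank_syzZ hf (t := ((∑ i, d i : ℕ) : ℤ)) (by omega)
    rw [Fin.sum_univ_three] at h1
    have h2 : 0 < Module.finrank k (syzZ f d ((∑ i, d i : ℕ) : ℤ)) := by
      simp only [Fin.sum_univ_three] at h1 ⊢
      push_cast at h1 ⊢
      omega
    have := finite_syzZ hf ((∑ i, d i : ℕ) : ℤ)
    obtain ⟨x, hx⟩ := Module.finrank_pos_iff_exists_ne_zero.1 h2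
    exact ⟨x, x.2, fun h ↦ hx (Subtype.ext h)⟩
  obtain ⟨g, hg, hg0⟩ := Nat.find_spec hex
  have hamin : ∀ (t : ℤ) (p : Fin 3 → MvPolynomial (Fin 2) k), p ∈ syzZ f d t → p ≠ 0 →
      (Nat.find hex : ℤ) ≤ t := by
    intro t p hp hp0
    have := nonneg_of_mem_syzZ hp hp0
    lift t to ℕ using this
    exact_mod_cast Nat.find_min' hex ⟨p, hp, hp0⟩
  generalize Nat.find hex = a at hg hamin
  have hgprim : IsPrimitiveTriple g := by
    obtain ⟨q, p, hqp, hp⟩ := exists_eq_mul_isPrimitiveTriple g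
    have hq0 : q ≠ 0 := by
      rintro rfl
      exact hg0 (funext fun i ↦ by simp [hqp i])
    obtain ⟨i, hi⟩ := hp.exists_ne_zero
    have hq : q ∈ homZ k (Fin 2) q.totalDegree := by
      refine mem_homZ_totalDegree_of_mul (mul_ne_zero hq0 hi) (z := a - d i) ?_
      rw [← hqp i]; exact hg.1 i
    have hps : p ∈ syzZ f d (a - q.totalDegree) := by
      refine ⟨fun j ↦ ?_, ?_⟩
      · have := hg.1 j
        rw [hqp j, mul_comm] at this
        have := mem_homZ_of_mul_right hq hq0 this
        rwa [show (a - d j - q.totalDegree : ℤ) = a - q.totalDegree - d j by ring] at this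
      · refine (mul_eq_zero.1 (?_ : q * _ = 0)).resolve_left hq0
        rw [← hg.2, Finset.mul_sum]
        exact Finset.sum_congr rfl fun j _ ↦ by rw [hqp j, mul_assoc]
    have := hamin _ p hps (fun h ↦ hi (by simp [h]))
    have hq1 : q.totalDegree = 0 := by omega
    rw [totalDegree_eq_zero_iff_eq_C] at hq1
    have hqu : IsUnit q := by
      rw [hq1]
      refine IsUnit.map _ (isUnit_iff_ne_zero.2 fun h ↦ hq0 ?_)
      rw [hq1, h, C_0]
    intro e he
    refine hp e fun j ↦ ?_
    have := he j
    rw [hqp j] at this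
    exact hqu.dvd_mul_left.1 this
  have hpar : ∀ p, crossProduct g p = 0 → ∃ e, ∀ i, p i = e * g i := fun p hp ↦
    hgprim.exists_eq_mul fun i j ↦ by
      have := crossProduct_eq_zero_iff.1 hp j i
      rw [mul_comm, this, mul_comm]
  have hex2 : ∃ n : ℕ, ∃ h ∈ syzZ f d (n : ℤ), crossProduct g h ≠ 0 := by
    by_contra! hcon
    have h1 := le_finrank_syzZ hf (t := ((∑ i, d i : ℕ) : ℤ)) (by omega)
    have h2 := finrank_syzZ_le_of_forall_eq_mul g hg hg0
      (fun p hp ↦ hpar p (hcon (∑ i, d i) p hp))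
    simp only [Fin.sum_univ_three] at h1 h2
    push_cast at h1 h2
    omega
  obtain ⟨h, hh, hgh⟩ := Nat.find_spec hex2
  have hbmin : ∀ (t : ℤ) (p : Fin 3 → MvPolynomial (Fin 2) k), p ∈ syzZ f d t →
      t < Nat.find hex2 → crossProduct g p = 0 := by
    intro t p hp hlt
    by_contra hne
    have := nonneg_of_mem_syzZ hp (by rintro rfl; simp at hne)
    lift t to ℕ using this
    exact Nat.find_min hex2 (by exact_mod_cast hlt) ⟨p, hp, hne⟩
  generalize Nat.find hex2 = b at hh hbmin
  have hab := hamin b h hh (by rintro rfl; simp at hgh)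
  have h1 := le_finrank_syzZ hf (t := (b : ℤ) - 1) (by omega)
  have h2 := finrank_syzZ_le_of_forall_eq_mul g hg hg0 (t := (b : ℤ) - 1)
    (fun p hp ↦ hpar p (hbmin _ p hp (by omega)))
  have h3 : ¬ ((a : ℤ) + b < ∑ i, (d i : ℤ)) := fun hlt ↦
    hgh (crossProduct_eq_zero_of_lt hf hprim hg hh hlt)
  have h4 : (a : ℤ) + b = ∑ i, (d i : ℤ) := by
    simp only [Fin.sum_univ_three] at h1 h3 ⊢
    omega
  obtain ⟨c, hc⟩ := hprim.exists_eq_mul (crossProduct_parallel hg.2 hh.2)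
  obtain ⟨i, hi⟩ := hprim.exists_ne_zero
  have h5 := crossProduct_mem_homZ hg.1 hh.1 i
  rw [hc i] at h5
  have h6 := mem_homZ_of_mul_right (hf i) hi h5
  obtain ⟨c', rfl⟩ := mem_homZ_zero (by simpa [h4] using h6)
  refine ⟨a, b, g, h, c', hab, h4, hg, hh, ?_, hc⟩
  rintro rfl
  exact hgh (funext fun j ↦ by simp [hc j])

theorem surjective_of_syzygy_basis (hf : ∀ i, f i ∈ homZ k (Fin 2) (d i))
    (hprim : IsPrimitiveTriple f) {a b : ℤ} {g h : Fin 3 → MvPolynomial (Fin 2) k}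
    (hgprim : IsPrimitiveTriple g) {c : k}
    (hab : a ≤ b) (hsum : a + b = ∑ i, (d i : ℤ)) (hg : g ∈ syzZ f d a) (hh : h ∈ syzZ f d b)
    (hc : c ≠ 0) (hgh : ∀ i, crossProduct g h i = C c * f i) {t : ℤ} (ht : b - 1 ≤ t) (ht0 : 0 ≤ t)
    {q : MvPolynomial (Fin 2) k} (hq : q ∈ homZ k (Fin 2) t) :
    ∃ p : Fin 3 → MvPolynomial (Fin 2) k,
      (∀ i, p i ∈ homZ k (Fin 2) (t - d i)) ∧ ∑ i, p i * f i = q := by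
  let φ : homZ k (Fin 2) (t - a) × homZ k (Fin 2) (t - b) →ₗ[k]
      (Fin 3 → MvPolynomial (Fin 2) k) :=
    (LinearMap.pi fun i ↦ LinearMap.mulRight k (g i) ∘ₗ Submodule.subtype _).coprod
      (LinearMap.pi fun i ↦ LinearMap.mulRight k (h i) ∘ₗ Submodule.subtype _)
  have hle : syzZ f d t ≤ LinearMap.range φ := by
    intro p hp
    obtain ⟨e', he'⟩ := hprim.exists_eq_mul (crossProduct_parallel hg.2 hp.2)
    obtain ⟨i, hi⟩ := hprim.exists_ne_zero
    obtain ⟨j, hj⟩ := hgprim.exists_ne_zero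
    have h1 : e' ∈ homZ k (Fin 2) (t - b) := by
      have h1 := crossProduct_mem_homZ hg.1 hp.1 i
      rw [he' i] at h1
      have h2 := mem_homZ_of_mul_right (hf i) hi h1
      rwa [← hsum, show a + t - (a + b) + d i - d i = t - b by ring] at h2
    have h2 : crossProduct g (fun i ↦ p i - C c⁻¹ * e' * h i) = 0 := by
      have e1 : (fun i ↦ p i - C c⁻¹ * e' * h i) = p - (C c⁻¹ * e') • h := by
        ext1 i; simp
      rw [e1, map_sub, map_smul]
      ext1 i
      simp only [Pi.sub_apply, Pi.smul_apply, smul_eq_mul, Pi.zero_apply, hgh i, he' i]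
      have : (C c⁻¹ * C c : MvPolynomial (Fin 2) k) = 1 := by
        rw [← C_mul, inv_mul_cancel₀ hc, C_1]
      linear_combination (-(e' * f i)) * this
    obtain ⟨e, he⟩ := hgprim.exists_eq_mul (v := fun i ↦ p i - C c⁻¹ * e' * h i) fun i j ↦ by
      have := crossProduct_eq_zero_iff.1 h2 j i
      rw [mul_comm, this, mul_comm]
    have h3 : C c⁻¹ * e' ∈ homZ k (Fin 2) (t - b) := C_mul_mem_homZ _ h1
    have h4 : e ∈ homZ k (Fin 2) (t - a) := by
      have h4 : e * g j ∈ homZ k (Fin 2) (t - d j) := by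
        rw [← he j]
        refine sub_mem (hp.1 j) ?_
        have := mul_mem_homZ h3 (hh.1 j)
        rwa [show t - b + (b - d j) = t - d j by ring] at this
      have := mem_homZ_of_mul_right (hg.1 j) hj h4
      rwa [show t - d j - (a - d j) = t - a by ring] at this
    refine ⟨(⟨e, h4⟩, ⟨C c⁻¹ * e', h3⟩), funext fun j ↦ ?_⟩
    have := he j
    simp only [φ, LinearMap.coprod_apply, LinearMap.pi_apply, LinearMap.comp_apply, Pi.add_apply,
      Submodule.subtype_apply, LinearMap.mulRight_apply]
    linear_combination -this
  have h1 := Submodule.finrank_mono hle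
  have h2 := LinearMap.finrank_range_le φ
  rw [Module.finrank_prod, finrank_homZ, finrank_homZ] at h2
  have h3 := finrank_syzZ_add_finrank_range hf t
  have h4 : LinearMap.range (combZ hf t) = ⊤ := by
    refine Submodule.eq_top_of_finrank_eq (le_antisymm (Submodule.finrank_le _) ?_)
    rw [finrank_homZ]
    simp only [Fin.sum_univ_three] at h3 hsum
    omega
  obtain ⟨p, hp⟩ := LinearMap.range_eq_top.1 h4 ⟨q, hq⟩
  exact ⟨fun i ↦ p i, fun i ↦ (p i).2, congrArg Subtype.val hp⟩

end Field

end

noncomputable section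

section Restriction

variable {K A A' : Type*} [Field K] [CommRing A] [Algebra K A] [CommRing A'] [Algebra K A']

/-- The restriction of a polynomial in `x, y, z` to the generic plane `z = u x + v y`. -/
def restrictPlane (u v : A) : MvPolynomial (Fin 3) K →ₐ[K] MvPolynomial (Fin 2) A :=
  aeval ![X 0, X 1, C u * X 0 + C v * X 1]

theorem map_restrictPlane (φ : A →ₐ[K] A') (u v : A) (p : MvPolynomial (Fin 3) K) :
    map (φ : A →+* A') (restrictPlane u v p) = restrictPlane (φ u) (φ v) p := by
  have : (mapAlgHom φ).comp (restrictPlane u v) = restrictPlane (K := K) (φ u) (φ v) := by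
    ext i : 1
    fin_cases i <;> simp [restrictPlane]
  exact congrArg (fun ψ ↦ ψ p) this

theorem restrictPlane_mem_homZ (u v : A) {z : ℤ} {p : MvPolynomial (Fin 3) K}
    (hp : p ∈ homZ K (Fin 3) z) : restrictPlane u v p ∈ homZ A (Fin 2) z := by
  by_cases h0 : p = 0
  · simp [h0]
  have := nonneg_of_mem_homZ h0 hp
  lift z to ℕ using this
  rw [mem_homZ_natCast] at hp ⊢
  have := hp.aeval (R := K) ![X 0, X 1, C u * X 0 + C v * X 1] (n := 1) (S := A) (τ := Fin 2) (by
    intro i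
    fin_cases i
    · exact isHomogeneous_X _ _
    · exact isHomogeneous_X _ _
    · exact (isHomogeneous_C_mul_X _ _).add (isHomogeneous_C_mul_X _ _))
  simpa [restrictPlane] using this

theorem isPrimitiveTriple_of_X_pow [IsDomain A] {f : Fin 3 → MvPolynomial (Fin 2) A} {N : ℕ}
    (h : ∀ i, X i ^ N ∈ Ideal.span (Set.range f)) : IsPrimitiveTriple f := by
  intro d hd
  have hle : Ideal.span (Set.range f) ≤ Ideal.span {d} := by
    rw [Ideal.span_le]
    rintro _ ⟨i, rfl⟩
    exact Ideal.mem_span_singleton.2 (hd i)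
  have h0 : d ∣ X 0 ^ N := Ideal.mem_span_singleton.1 (hle (h 0))
  have h1 : d ∣ X 1 ^ N := Ideal.mem_span_singleton.1 (hle (h 1))
  have hp : Prime (X 0 : MvPolynomial (Fin 2) A) := X_prime
  obtain ⟨k, -, hk⟩ := (dvd_prime_pow hp N).1 h0
  rcases k with _ | k
  · exact associated_one_iff_isUnit.1 (by simpa only [pow_zero] using hk)
  · exfalso
    have h2 : (X 0 : MvPolynomial (Fin 2) A) ∣ X 1 :=
      hp.dvd_of_dvd_pow (((dvd_pow_self _ k.succ_ne_zero).trans hk.symm.dvd).trans h1)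
    simp [X_dvd_X] at h2

theorem isPrimitiveTriple_restrictPlane [IsDomain A] (u v : A)
    {f : Fin 3 → MvPolynomial (Fin 3) K} {N : ℕ}
    (h : ∀ i, X i ^ N ∈ Ideal.span (Set.range f)) :
    IsPrimitiveTriple fun i ↦ restrictPlane u v (f i) := by
  refine isPrimitiveTriple_of_X_pow (N := N) fun i ↦ ?_
  have key := Ideal.mem_map_of_mem (restrictPlane (A := A) u v) (h (Fin.castSucc i))
  rw [Ideal.map_span, ← Set.range_comp] at key
  have hX : restrictPlane (K := K) u v (X i.castSucc ^ N) = X i ^ N := by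
    fin_cases i <;> simp [restrictPlane]
  rwa [hX] at key

/-- The inclusion of `K[x, y]` in `K[x, y, z]`. -/
def inclPlane : MvPolynomial (Fin 2) K →ₐ[K] MvPolynomial (Fin 3) K :=
  rename Fin.castSucc

theorem inclPlane_mem_homZ {z : ℤ} {p : MvPolynomial (Fin 2) K} (hp : p ∈ homZ K (Fin 2) z) :
    inclPlane p ∈ homZ K (Fin 3) z := by
  by_cases h0 : p = 0
  · simp [h0]
  have := nonneg_of_mem_homZ h0 hp
  lift z to ℕ using this
  rw [mem_homZ_natCast] at hp ⊢
  exact hp.rename_isHomogeneous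

theorem restrictPlane_inclPlane (u v : K) (p : MvPolynomial (Fin 2) K) :
    restrictPlane u v (inclPlane p) = p := by
  have : (restrictPlane (K := K) u v).comp inclPlane = AlgHom.id K _ := by
    ext i : 1
    fin_cases i <;> simp [restrictPlane, inclPlane]
  exact congrArg (fun ψ ↦ ψ p) this

theorem dvd_of_restrictPlane_eq_zero (u v : K) {p : MvPolynomial (Fin 3) K}
    (hp : restrictPlane u v p = 0) : X 2 - C u * X 0 - C v * X 1 ∣ p := by
  rw [← Ideal.mem_span_singleton, ← Ideal.Quotient.eq_zero_iff_mem]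
  have : ((Ideal.Quotient.mkₐ K (Ideal.span {X 2 - C u * X 0 - C v * X 1})).comp
      inclPlane).comp (restrictPlane u v) = Ideal.Quotient.mkₐ K _ := by
    ext i : 1
    fin_cases i
    · simp [restrictPlane, inclPlane]
    · simp [restrictPlane, inclPlane]
    · simp only [restrictPlane, inclPlane, AlgHom.comp_apply, aeval_X]
      refine Ideal.Quotient.eq.2 (Ideal.mem_span_singleton.2 ⟨-1, ?_⟩)
      simp
      ring
  have := congrArg (fun ψ ↦ ψ p) this
  simp only [AlgHom.comp_apply, hp, map_zero] at this
  exact this.symm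

theorem restrictPlane_linear (u v : K) : restrictPlane u v (X 2 - C u * X 0 - C v * X 1) = 0 := by
  simp [restrictPlane, algHom_C]

end Restriction

section Generic

theorem exists_map_eq_C_mul {ι σ B : Type*} [Finite ι] [CommRing B] [IsDomain B] (F : Type*)
    [Field F] [Algebra B F] [IsFractionRing B F] (g : ι → MvPolynomial σ F) :
    ∃ c : B, c ≠ 0 ∧ ∃ q : ι → MvPolynomial σ B,
      ∀ i, map (algebraMap B F) (q i) = C (algebraMap B F c) * g i := by
  let : Algebra (MvPolynomial σ B) (MvPolynomial σ F) := algebraMvPolynomial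
  obtain ⟨⟨_, c, hc, rfl⟩, hm⟩ := IsLocalization.exist_integer_multiples_of_finite
    ((nonZeroDivisors B).map (C (σ := σ))) g
  choose q hq using hm
  refine ⟨c, nonZeroDivisors.ne_zero hc, q, fun i ↦ ?_⟩
  have := hq i
  rw [Algebra.smul_def, algebraMap_def, map_C] at this
  exact this

variable {B : Type*} [CommRing B] [IsDomain B]
  [UniqueFactorizationMonoid (MvPolynomial (Fin 2) B)]

theorem exists_generic_syzygy_basis {f : Fin 3 → MvPolynomial (Fin 2) B} {d : Fin 3 → ℕ}
    (hf : ∀ i, f i ∈ homZ B (Fin 2) (d i)) (hprim : IsPrimitiveTriple f)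
    (hprimF : IsPrimitiveTriple fun i ↦ map (algebraMap B (FractionRing B)) (f i)) :
    ∃ (a b : ℤ) (g h : Fin 3 → MvPolynomial (Fin 2) B) (c : B), a ≤ b ∧
      a + b = ∑ i, (d i : ℤ) ∧ g ∈ syzZ f d a ∧ h ∈ syzZ f d b ∧ c ≠ 0 ∧
      (∀ i, crossProduct g h i = C c * f i) ∧ IsPrimitiveTriple g := by
  set φ := algebraMap B (FractionRing B)
  have hinj : Function.Injective φ := IsFractionRing.injective B (FractionRing B)
  have hinj' : Function.Injective (map (σ := Fin 2) φ) := map_injective _ hinj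
  have hφ0 : ∀ {c : B}, c ≠ 0 → φ c ≠ 0 := fun h h' ↦ h ((map_eq_zero_iff _ hinj).1 h')
  obtain ⟨a, b, g, h, c, hab, hsum, hg, hh, hc, hgh⟩ :=
    exists_syzygy_basis (fun i ↦ map_mem_homZ φ (hf i)) hprimF
  have clear : ∀ {t : ℤ} {p : Fin 3 → MvPolynomial (Fin 2) (FractionRing B)},
      p ∈ syzZ (fun i ↦ map φ (f i)) d t → ∃ s : B, s ≠ 0 ∧ ∃ q ∈ syzZ f d t,
        ∀ i, map φ (q i) = C (φ s) * p i := by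
    intro t p hp
    obtain ⟨s, hs, q, hq⟩ := exists_map_eq_C_mul (B := B) (FractionRing B) p
    refine ⟨s, hs, q, ⟨fun i ↦ mem_homZ_of_map hinj ?_, hinj' ?_⟩, hq⟩
    · rw [hq]; exact C_mul_mem_homZ _ (hp.1 i)
    · have := hp.2
      rw [map_sum, map_zero, ← mul_zero (C (φ s)), ← this, Finset.mul_sum]
      exact Finset.sum_congr rfl fun i _ ↦ by rw [map_mul, hq, mul_assoc]
  obtain ⟨s, hs, g', hg', hgs⟩ := clear hg
  obtain ⟨r, hr, h', hh', hhr⟩ := clear hh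
  obtain ⟨q, g₀, hq, hg₀⟩ := exists_eq_mul_isPrimitiveTriple g'
  have hgh' : ∀ i, map φ (crossProduct g' h' i) = C (φ s * φ r * c) * map φ (f i) := by
    intro i
    have e := hgh i
    rw [cross_apply] at e ⊢
    fin_cases i <;> simp [hgs, hhr] at e ⊢ <;> linear_combination (C (φ s) * C (φ r)) * e
  obtain ⟨w, hw⟩ := hprim.exists_eq_mul (crossProduct_parallel hg'.2 hh'.2)
  obtain ⟨i₀, hi₀⟩ := hprim.exists_ne_zero
  have hwC : map φ w = C (φ s * φ r * c) := by
    have := hgh' i₀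
    rw [hw, map_mul] at this
    exact mul_right_cancel₀ (fun h ↦ hi₀ (hinj' (by rw [h, map_zero]))) this
  obtain ⟨c', rfl⟩ : ∃ c', w = C c' := mem_homZ_zero (mem_homZ_of_map hinj (by
    rw [hwC]; exact C_mem_homZ _))
  have hc' : c' ≠ 0 := by
    rintro rfl
    rw [C_0, map_zero] at hwC
    exact mul_ne_zero (mul_ne_zero (hφ0 hs) (hφ0 hr)) hc (C_injective _ _ (by rw [← hwC, C_0]))
  have hcr : ∀ i, crossProduct g' h' i = q * crossProduct g₀ h' i := by
    intro i
    have : g' = q • g₀ := funext fun i ↦ by simp [hq i]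
    rw [this, map_smul]
    simp
  have hqC : q ∣ C c' := hprim.dvd_of_forall_dvd_mul fun i ↦ ⟨_, by rw [← hw i, hcr i]⟩
  obtain ⟨q', hq', rfl⟩ := (dvd_C_iff_exists hc').1 hqC
  obtain ⟨c'', rfl⟩ := hq'
  have hq0 : q' ≠ 0 := left_ne_zero_of_mul hc'
  have hC0 : (C q' : MvPolynomial (Fin 2) B) ≠ 0 := by simpa using hq0
  refine ⟨a, b, g₀, h', c'', hab, hsum, ⟨fun i ↦ ?_, ?_⟩, hh', right_ne_zero_of_mul hc',
    fun i ↦ mul_left_cancel₀ hC0 ?_, hg₀⟩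
  · have := hg'.1 i
    rw [hq i, mul_comm] at this
    simpa using mem_homZ_of_mul_right (C_mem_homZ q') hC0 this
  · refine (mul_eq_zero.1 (?_ : C q' * _ = 0)).resolve_left hC0
    rw [← hg'.2, Finset.mul_sum]
    exact Finset.sum_congr rfl fun j _ ↦ by rw [hq j, mul_assoc]
  · rw [← hcr, hw, C_mul, mul_assoc]

end Generic

end

noncomputable section

theorem coeff_coeff_commAlgEquiv {R S₁ S₂ : Type*} [CommRing R]
    (p : MvPolynomial S₁ (MvPolynomial S₂ R)) (m : S₂ →₀ ℕ) (d : S₁ →₀ ℕ) :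
    coeff d (coeff m (commAlgEquiv R S₁ S₂ p)) = coeff m (coeff d p) := by
  classical
  induction p using MvPolynomial.induction_on' with
  | add p q hp hq => simp [hp, hq]
  | monomial e b =>
    induction b using MvPolynomial.induction_on' with
    | add p q hp hq => simp only [map_add, coeff_add, hp, hq]
    | monomial n r =>
      have : commAlgEquiv R S₁ S₂ (monomial e (monomial n r)) = monomial n (monomial e r) :=
        AddMonoidAlgebra.commAlgEquiv_single_single _ _ _
      rw [this]
      simp only [coeff_monomial]
      split_ifs <;> simp_all

theorem mem_homZ_iff_forall_coeff_commAlgEquiv {R S₁ S₂ : Type*} [CommRing R] {z : ℤ}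
    {p : MvPolynomial S₁ (MvPolynomial S₂ R)} :
    p ∈ homZ (MvPolynomial S₂ R) S₁ z ↔
      ∀ m, coeff m (commAlgEquiv R S₁ S₂ p) ∈ homZ R S₁ z := by
  constructor
  · intro h m d hd
    rw [coeff_coeff_commAlgEquiv] at hd
    exact h d fun h0 ↦ hd (by simp [h0])
  · intro h d hd
    obtain ⟨m, hm⟩ := MvPolynomial.ne_zero_iff.1 hd
    rw [← coeff_coeff_commAlgEquiv] at hm
    exact h m d hm

section Derivation

variable {K : Type*} [Field K]

/-- The derivation `y ∂/∂u - x ∂/∂v` of `K[x, y][u, v]`. -/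
def rotDer : Derivation (MvPolynomial (Fin 2) K) (MvPolynomial (Fin 2) (MvPolynomial (Fin 2) K))
    (MvPolynomial (Fin 2) (MvPolynomial (Fin 2) K)) :=
  (X 1 : MvPolynomial (Fin 2) K) • pderiv 0 - (X 0 : MvPolynomial (Fin 2) K) • pderiv 1

theorem coeff_rotDer (p : MvPolynomial (Fin 2) (MvPolynomial (Fin 2) K)) (m : Fin 2 →₀ ℕ) :
    coeff m (rotDer p) =
      X 1 * (coeff (m + Finsupp.single 0 1) p * ((m 0 + 1 : ℕ) : MvPolynomial (Fin 2) K)) -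
      X 0 * (coeff (m + Finsupp.single 1 1) p * ((m 1 + 1 : ℕ) : MvPolynomial (Fin 2) K)) := by
  simp [rotDer, coeff_pderiv]

/-- The generic restriction, as a map to `K[x, y][u, v]`. -/
def restrictPlaneSwap :
    MvPolynomial (Fin 3) K →ₐ[K] MvPolynomial (Fin 2) (MvPolynomial (Fin 2) K) :=
  aeval ![C (X 0), C (X 1), X 0 * C (X 0) + X 1 * C (X 1)]

theorem commAlgEquiv_restrictPlane (p : MvPolynomial (Fin 3) K) :
    commAlgEquiv K (Fin 2) (Fin 2) (restrictPlane (X 0) (X 1) p) = restrictPlaneSwap p := by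
  have : (commAlgEquiv K (Fin 2) (Fin 2)).toAlgHom.comp (restrictPlane (X 0) (X 1)) =
      restrictPlaneSwap (K := K) := by
    ext i : 1
    fin_cases i <;> simp [restrictPlane, restrictPlaneSwap]
  exact congrArg (fun ψ ↦ ψ p) this

theorem rotDer_restrictPlaneSwap (p : MvPolynomial (Fin 3) K) :
    rotDer (restrictPlaneSwap p) = 0 := by
  induction p using MvPolynomial.induction_on with
  | C a =>
    have : restrictPlaneSwap (C a : MvPolynomial (Fin 3) K) = C (C a) := algHom_C _ _
    rw [this]
    exact rotDer.map_algebraMap _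
  | add p q hp hq => simp [hp, hq]
  | mul_X p i hp =>
    rw [map_mul, Derivation.leibniz, hp, smul_zero, add_zero]
    convert smul_zero _
    have hC : ∀ a : MvPolynomial (Fin 2) K, rotDer (C a) = 0 := fun a ↦ rotDer.map_algebraMap a
    fin_cases i
    · simp [restrictPlaneSwap, hC]
    · simp [restrictPlaneSwap, hC]
    · simp [restrictPlaneSwap, Derivation.leibniz, rotDer, pderiv_X, smul_eq_C_mul]
      ring

theorem totalDegree_rotDer_lt (p : MvPolynomial (Fin 2) (MvPolynomial (Fin 2) K))
    (h : rotDer p ≠ 0) : (rotDer p).totalDegree < p.totalDegree := by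
  have key : ∀ m, coeff m (rotDer p) ≠ 0 → m.degree + 1 ≤ p.totalDegree := by
    intro m hm
    have hdeg : ∀ i : Fin 2, coeff (m + Finsupp.single i 1) p ≠ 0 →
        m.degree + 1 ≤ p.totalDegree := by
      intro i hi
      have := le_totalDegree (mem_support_iff.2 hi)
      change (m + Finsupp.single i 1).degree ≤ _ at this
      simpa using this
    rw [coeff_rotDer] at hm
    by_cases h0 : coeff (m + Finsupp.single 0 1) p = 0
    · by_cases h1 : coeff (m + Finsupp.single 1 1) p = 0
      · simp [h0, h1] at hm
      · exact hdeg 1 h1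
    · exact hdeg 0 h0
  obtain ⟨m, hm⟩ := MvPolynomial.ne_zero_iff.1 h
  rw [totalDegree, Finset.sup_lt_iff (by have := key m hm; simp; omega)]
  intro n hn
  exact key n (mem_support_iff.1 hn)

theorem pow_mul_coeff_of_rotDer_eq_zero {p : MvPolynomial (Fin 2) (MvPolynomial (Fin 2) K)}
    (h : rotDer p = 0) (i j : ℕ) :
    X 1 ^ i * (((i.factorial * j.factorial : ℕ) : MvPolynomial (Fin 2) K) *
      coeff (Finsupp.single 0 i + Finsupp.single 1 j) p) =
    X 0 ^ i * (((i + j).factorial : MvPolynomial (Fin 2) K) * coeff (Finsupp.single 1 (i + j)) p) := by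
  induction i generalizing j with
  | zero => simp
  | succ i ih =>
    have h1 := ih (j + 1)
    have h2 := coeff_rotDer p (Finsupp.single 0 i + Finsupp.single 1 j)
    rw [h, coeff_zero] at h2
    have e1 : (Finsupp.single 0 i + Finsupp.single 1 j + Finsupp.single 0 1 : Fin 2 →₀ ℕ) =
        Finsupp.single 0 (i + 1) + Finsupp.single 1 j := by
      rw [Finsupp.single_add]; abel
    have e2 : (Finsupp.single 0 i + Finsupp.single 1 j + Finsupp.single 1 1 : Fin 2 →₀ ℕ) =
        Finsupp.single 0 i + Finsupp.single 1 (j + 1) := by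
      rw [Finsupp.single_add]; abel
    rw [e1, e2] at h2
    simp only [Finsupp.add_apply, Finsupp.single_apply] at h2
    rw [show i + (j + 1) = i + 1 + j by ring] at h1
    simp [Nat.factorial_succ, pow_succ] at h1 h2 ⊢
    linear_combination X 0 * h1 - (X 1 ^ i * (i.factorial : MvPolynomial (Fin 2) K) *
      (j.factorial : MvPolynomial (Fin 2) K)) * h2

theorem coeff_single_one_linear_pow (a b : MvPolynomial (Fin 2) K) (m n : ℕ) :
    coeff (Finsupp.single (1 : Fin 2) n) ((X 0 * C a + X 1 * C b) ^ m) =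
      if n = m then b ^ m else 0 := by
  classical
  have hC (q : MvPolynomial (Fin 2) (MvPolynomial (Fin 2) K)) (c : MvPolynomial (Fin 2) K)
      (e : Fin 2 →₀ ℕ) : coeff e (q * C c) = coeff e q * c := by
    rw [mul_comm, coeff_C_mul, mul_comm]
  induction m generalizing n with
  | zero =>
    rw [pow_zero, coeff_one]
    simp [eq_comm]
  | succ m ih =>
    rw [pow_succ, mul_add, ← mul_assoc, ← mul_assoc, coeff_add, hC, hC,
      coeff_mul_X', coeff_mul_X']
    rcases n with _ | n
    · simp
    · simp [ih, pow_succ]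

theorem exists_restrictPlaneSwap_eq [CharZero K] {p : MvPolynomial (Fin 2) (MvPolynomial (Fin 2) K)}
    (h : rotDer p = 0) : ∃ G, restrictPlaneSwap G = p := by
  classical
  have hfac : ∀ n : ℕ, ∃ u : MvPolynomial (Fin 2) K, u * (n.factorial : ℕ) = 1 := fun n ↦
    ⟨C (n.factorial : K)⁻¹, by
      rw [← map_natCast (C : K →+* MvPolynomial (Fin 2) K), ← C_mul,
        inv_mul_cancel₀ (by exact_mod_cast n.factorial_ne_zero), C_1]⟩
  have hdvd : ∀ n, ∃ s : MvPolynomial (Fin 2) K, coeff (Finsupp.single 1 n) p = X 1 ^ n * s := by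
    intro n
    have h1 := pow_mul_coeff_of_rotDer_eq_zero h n 0
    have hX : Prime (X 1 : MvPolynomial (Fin 2) K) := X_prime
    have h2 : X 1 ^ n ∣ (n.factorial * coeff (Finsupp.single 1 n) p : MvPolynomial (Fin 2) K) := by
      refine hX.pow_dvd_of_dvd_mul_left n (a := X 0 ^ n) (fun hd ↦ ?_) ⟨_, h1.symm⟩
      have := hX.dvd_of_dvd_pow hd
      simp [X_dvd_X] at this
    obtain ⟨u, hu⟩ := hfac n
    obtain ⟨s, hs⟩ := h2
    exact ⟨u * s, by linear_combination (-coeff (Finsupp.single 1 n) p) * hu + u * hs⟩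
  choose s hs using hdvd
  let G : MvPolynomial (Fin 3) K :=
    ∑ n ∈ Finset.range (p.totalDegree + 1), inclPlane (s n) * X 2 ^ n
  refine ⟨G, Eq.symm <| sub_eq_zero.1 ?_⟩
  have hincl : ∀ q : MvPolynomial (Fin 2) K, restrictPlaneSwap (inclPlane q) = C q := by
    intro q
    have : restrictPlaneSwap.comp inclPlane =
        IsScalarTower.toAlgHom K (MvPolynomial (Fin 2) K) _ := by
      ext i : 1
      fin_cases i <;> simp [restrictPlaneSwap, inclPlane, algebraMap_eq]
    exact congrArg (fun ψ ↦ ψ q) this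
  have hrot : rotDer (p - restrictPlaneSwap G) = 0 := by
    rw [map_sub, h, rotDer_restrictPlaneSwap, sub_zero]
  have h0 : ∀ n, coeff (Finsupp.single 1 n) (p - restrictPlaneSwap G) = 0 := by
    intro n
    have hX2 : restrictPlaneSwap (X 2 : MvPolynomial (Fin 3) K) =
      X 0 * C (X 0) + X 1 * C (X 1) := by simp [restrictPlaneSwap]
    simp only [G, coeff_sub, map_sum, map_mul, map_pow, hincl, hX2, coeff_sum, coeff_C_mul,
      coeff_single_one_linear_pow, mul_ite, mul_zero, Finset.sum_ite_eq, Finset.mem_range]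
    split_ifs with hn
    · rw [hs, mul_comm, sub_self]
    · rw [sub_zero]
      by_contra hne
      have := le_totalDegree (mem_support_iff.2 hne)
      simp at this
      omega
  ext1 m
  have h1 := pow_mul_coeff_of_rotDer_eq_zero hrot (m 0) (m 1)
  have hm : Finsupp.single 0 (m 0) + Finsupp.single 1 (m 1) = m := by
    ext i; fin_cases i <;> simp
  rw [h0, hm, mul_zero, mul_zero] at h1
  rw [coeff_zero]
  refine ((mul_eq_zero.1 ((mul_eq_zero.1 h1).resolve_left ?_)).resolve_left ?_)
  · exact pow_ne_zero _ (X_ne_zero _)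
  · exact_mod_cast mul_ne_zero (Nat.factorial_ne_zero _) (Nat.factorial_ne_zero _)

end Derivation

section Lift

variable {K : Type*} [Field K]

theorem restrictPlane_generic_injective :
    Function.Injective (restrictPlane (K := K) (X 0 : MvPolynomial (Fin 2) K) (X 1)) := by
  let L := FractionRing (MvPolynomial (Fin 3) K)
  let ι : MvPolynomial (Fin 3) K →ₐ[K] L := IsScalarTower.toAlgHom K _ L
  have hι : Function.Injective ι := IsFractionRing.injective _ L
  let χ : MvPolynomial (Fin 2) (MvPolynomial (Fin 2) K) →+* L :=
    eval₂Hom (aeval ![ι (X 2) / ι (X 0), 0] : MvPolynomial (Fin 2) K →ₐ[K] L).toRingHom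
      ![ι (X 0), ι (X 1)]
  have hX : ι (X 0) ≠ 0 := fun h ↦ X_ne_zero (R := K) (0 : Fin 3) (hι (by rw [h, map_zero]))
  have : χ.comp (restrictPlane (K := K) (X 0) (X 1)).toRingHom = ι.toRingHom := by
    refine MvPolynomial.ringHom_ext (fun r ↦ ?_) fun i ↦ ?_
    · simp [χ, restrictPlane, algHom_C, MvPolynomial.algebraMap_apply, algebraMap_eq]
    · fin_cases i
      · simp [χ, restrictPlane]
      · simp [χ, restrictPlane]
      · simp [χ, restrictPlane]
        exact div_mul_cancel₀ _ hX
  refine Function.Injective.of_comp (f := χ) ?_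
  convert hι using 1
  exact congrArg DFunLike.coe this

theorem exists_syzygy_lift [CharZero K] {f : Fin 3 → MvPolynomial (Fin 3) K} {d : Fin 3 → ℕ}
    (hf : ∀ i, f i ∈ homZ K (Fin 3) (d i))
    (hprim : IsPrimitiveTriple fun i ↦
      restrictPlane (X 0 : MvPolynomial (Fin 2) K) (X 1) (f i)) {a : ℤ}
    {g : Fin 3 → MvPolynomial (Fin 2) (MvPolynomial (Fin 2) K)}
    (hg : g ∈ syzZ (fun i ↦ restrictPlane (X 0) (X 1) (f i)) d a) (hgprim : IsPrimitiveTriple g)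
    (ha : 2 * a + 1 < ∑ i, (d i : ℤ)) :
    ∃ G : Fin 3 → MvPolynomial (Fin 3) K, (∀ i, restrictPlane (X 0) (X 1) (G i) = g i) ∧
      ∑ i, G i * f i = 0 := by
  let σ := commAlgEquiv K (Fin 2) (Fin 2)
  let δ : Fin 3 → MvPolynomial (Fin 2) (MvPolynomial (Fin 2) K) :=
    fun i ↦ σ.symm (rotDer (σ (g i)))
  have hδ : δ ∈ syzZ (fun i ↦ restrictPlane (X 0) (X 1) (f i)) d (a + 1) := by
    refine ⟨fun i ↦ mem_homZ_iff_forall_coeff_commAlgEquiv.2 fun m ↦ ?_, σ.injective ?_⟩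
    · have hgi := mem_homZ_iff_forall_coeff_commAlgEquiv.1 (hg.1 i)
      have h1 : ∀ (j l : Fin 2) (n : ℕ),
          X j * (coeff (m + Finsupp.single l 1) (σ (g i)) * ((n + 1 : ℕ) : MvPolynomial (Fin 2) K)) ∈
          homZ K (Fin 2) (a + 1 - d i) := by
        intro j l n
        have h2 := mul_mem_homZ (X_mem_homZ j) (C_mul_mem_homZ (n + 1 : K)
          (hgi (m + Finsupp.single l 1)))
        rw [show 1 + (a - d i) = a + 1 - d i by ring] at h2
        convert h2 using 2
        rw [mul_comm]
        simp [σ]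
      change coeff m (σ (σ.symm _)) ∈ _
      rw [AlgEquiv.apply_symm_apply, coeff_rotDer]
      exact sub_mem (h1 _ _ _) (h1 _ _ _)
    · have h1 := congrArg (fun q ↦ rotDer (σ q)) hg.2
      simp only [map_sum, map_mul, map_zero, Derivation.leibniz, σ, commAlgEquiv_restrictPlane,
        rotDer_restrictPlaneSwap, smul_zero, zero_add] at h1
      simp only [δ, map_sum, map_mul, map_zero, AlgEquiv.apply_symm_apply]
      rw [← h1]
      refine Finset.sum_congr rfl fun i _ ↦ ?_
      simp only [σ, commAlgEquiv_restrictPlane, smul_eq_mul]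
      exact mul_comm _ _
  have hcr := crossProduct_eq_zero_of_lt (fun i ↦ restrictPlane_mem_homZ (X 0) (X 1) (hf i)) hprim
    hg hδ (by omega)
  obtain ⟨e, he⟩ := hgprim.exists_eq_mul (v := δ) fun i j ↦ by
    have := crossProduct_eq_zero_iff.1 hcr j i
    rw [mul_comm, this, mul_comm]
  have he' : ∀ i, rotDer (σ (g i)) = σ e * σ (g i) := by
    intro i
    rw [← map_mul, ← he i, AlgEquiv.apply_symm_apply]
  have he0 : e = 0 := by
    by_contra hne
    obtain ⟨i, hi⟩ := hgprim.exists_ne_zero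
    have h1 : σ e ≠ 0 := by simpa using hne
    have h2 : σ (g i) ≠ 0 := by simpa using hi
    have h3 := totalDegree_rotDer_lt (σ (g i)) (by rw [he' i]; exact mul_ne_zero h1 h2)
    rw [he' i, totalDegree_mul_of_isDomain h1 h2] at h3
    omega
  have h0 : ∀ i, rotDer (σ (g i)) = 0 := fun i ↦ by rw [he' i, he0, map_zero, zero_mul]
  choose G hG using fun i ↦ exists_restrictPlaneSwap_eq (h0 i)
  have hG' : ∀ i, restrictPlane (X 0) (X 1) (G i) = g i := fun i ↦ σ.injective (by
    rw [← hG i]; exact commAlgEquiv_restrictPlane _)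
  refine ⟨G, hG', restrictPlane_generic_injective ?_⟩
  simpa only [map_sum, map_mul, hG', map_zero] using hg.2

end Lift

end

noncomputable section

section Specialization

variable {K : Type*} [Field K]

theorem IsPrimitiveTriple.of_crossProduct {f g h : Fin 3 → MvPolynomial (Fin 2) K}
    (hf : IsPrimitiveTriple f) {c : K} (hc : c ≠ 0)
    (hgh : ∀ i, crossProduct g h i = C c * f i) : IsPrimitiveTriple g := by
  intro d hd
  refine hf d fun i ↦ ?_
  have hu : IsUnit (C c : MvPolynomial (Fin 2) K) := (isUnit_iff_ne_zero.2 hc).map C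
  rw [← hu.dvd_mul_left, ← hgh i, cross_apply]
  fin_cases i <;> exact dvd_sub ((hd _).mul_right _) ((hd _).mul_right _)

/-- A syzygy basis of the restriction to some line, whose first member lifts to a syzygy of `f`
unless the degrees of its two members differ by at most one. -/
theorem exists_line_syzygy_basis [CharZero K] {f : Fin 3 → MvPolynomial (Fin 3) K} {d : Fin 3 → ℕ}
    (hf : ∀ i, f i ∈ homZ K (Fin 3) (d i)) {N : ℕ}
    (hN : ∀ i, X i ^ N ∈ Ideal.span (Set.range f)) :
    ∃ (u v : K) (a b : ℤ) (g h : Fin 3 → MvPolynomial (Fin 2) K) (c : K), a ≤ b ∧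
      a + b = ∑ i, (d i : ℤ) ∧ g ∈ syzZ (fun i ↦ restrictPlane u v (f i)) d a ∧
      h ∈ syzZ (fun i ↦ restrictPlane u v (f i)) d b ∧ c ≠ 0 ∧
      (∀ i, crossProduct g h i = C c * restrictPlane u v (f i)) ∧ IsPrimitiveTriple g ∧
      (a + 2 ≤ b → ∃ G : Fin 3 → MvPolynomial (Fin 3) K, (∀ i, restrictPlane u v (G i) = g i) ∧
        ∑ i, G i * f i = 0) := by
  have hprim := isPrimitiveTriple_restrictPlane (X 0 : MvPolynomial (Fin 2) K) (X 1) hN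
  have hprimF : IsPrimitiveTriple fun i ↦ map (algebraMap (MvPolynomial (Fin 2) K)
      (FractionRing (MvPolynomial (Fin 2) K))) (restrictPlane (X 0) (X 1) (f i)) := by
    have := isPrimitiveTriple_restrictPlane (A := FractionRing (MvPolynomial (Fin 2) K))
      (algebraMap (MvPolynomial (Fin 2) K) _ (X 0)) (algebraMap (MvPolynomial (Fin 2) K) _ (X 1)) hN
    convert this using 2 with i
    exact map_restrictPlane (IsScalarTower.toAlgHom K (MvPolynomial (Fin 2) K)
      (FractionRing (MvPolynomial (Fin 2) K))) (X 0) (X 1) (f i)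
  obtain ⟨a, b, g, h, c, hab, hsum, hg, hh, hc, hgh, hgprim⟩ :=
    exists_generic_syzygy_basis (fun i ↦ restrictPlane_mem_homZ (X 0) (X 1) (hf i)) hprim hprimF
  obtain ⟨w, hw⟩ : ∃ w : Fin 2 → K, eval w c ≠ 0 := by
    by_contra! hcon
    exact hc (MvPolynomial.funext fun w ↦ by rw [hcon w, map_zero])
  let ε : MvPolynomial (Fin 2) K →ₐ[K] K := aeval w
  have hε : ∀ q : MvPolynomial (Fin 3) K,
      map (ε : MvPolynomial (Fin 2) K →+* K) (restrictPlane (X 0) (X 1) q) =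
        restrictPlane (w 0) (w 1) q := by
    intro q
    rw [map_restrictPlane]
    simp [ε]
  have hsyz : ∀ {t : ℤ} {p : Fin 3 → MvPolynomial (Fin 2) (MvPolynomial (Fin 2) K)},
      p ∈ syzZ (fun i ↦ restrictPlane (X 0) (X 1) (f i)) d t →
      (fun i ↦ map (ε : MvPolynomial (Fin 2) K →+* K) (p i)) ∈
        syzZ (fun i ↦ restrictPlane (w 0) (w 1) (f i)) d t := by
    intro t p hp
    refine ⟨fun i ↦ map_mem_homZ _ (hp.1 i), ?_⟩
    have := congrArg (map (ε : MvPolynomial (Fin 2) K →+* K)) hp.2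
    simpa only [map_sum, map_mul, map_zero, hε] using this
  have hc' : ε c ≠ 0 := by simpa [ε, coe_aeval_eq_eval] using hw
  have hgh' : ∀ i, crossProduct (fun i ↦ map (ε : MvPolynomial (Fin 2) K →+* K) (g i))
      (fun i ↦ map (ε : MvPolynomial (Fin 2) K →+* K) (h i)) i =
        C (ε c) * restrictPlane (w 0) (w 1) (f i) := by
    intro i
    have := congrArg (map (ε : MvPolynomial (Fin 2) K →+* K)) (hgh i)
    rw [map_mul, hε, map_C] at this
    refine Eq.trans ?_ this
    rw [cross_apply, cross_apply]
    fin_cases i <;> simp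
  refine ⟨w 0, w 1, a, b, _, _, ε c, hab, hsum, hsyz hg, hsyz hh, hc', hgh',
    (isPrimitiveTriple_restrictPlane (w 0) (w 1) hN).of_crossProduct hc' hgh', fun h2 ↦ ?_⟩
  obtain ⟨G, hG, hG0⟩ := exists_syzygy_lift hf hprim hg hgprim (by omega)
  exact ⟨G, fun i ↦ by rw [← hε, hG], hG0⟩

end Specialization

section Lefschetz

variable {K : Type*} [Field K]

theorem mem_hcomp_iff {r : ℕ} {z : ℤ} {p : MvPolynomial (Fin r) K} :
    p ∈ hcomp K r z ↔ p ∈ homZ K (Fin r) z := by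
  rw [hcomp]
  split_ifs with h
  · lift z to ℕ using h
    exact mem_homZ_natCast.symm
  · refine ⟨?_, fun hp ↦ eq_zero_of_mem_homZ_of_neg (by omega) hp⟩
    rintro rfl
    exact zero_mem _

theorem mem_quotPiece_iff {r : ℕ} {I : Ideal (MvPolynomial (Fin r) K)} {t : ℤ}
    {x : MvPolynomial (Fin r) K ⧸ I} :
    x ∈ quotPiece I t ↔ ∃ p ∈ homZ K (Fin r) t, Ideal.Quotient.mk I p = x := by
  simp only [quotPiece, Submodule.mem_map, mem_hcomp_iff]
  rfl

/-- Membership of a form in the ideal of three forms is witnessed by forms. -/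
theorem exists_homZ_of_mem_span {f : Fin 3 → MvPolynomial (Fin 3) K} {d : Fin 3 → ℕ}
    (hf : ∀ i, f i ∈ homZ K (Fin 3) (d i)) {t : ℤ} {p : MvPolynomial (Fin 3) K}
    (hp : p ∈ homZ K (Fin 3) t) (hmem : p ∈ Ideal.span (Set.range f)) :
    ∃ G : Fin 3 → MvPolynomial (Fin 3) K,
      (∀ i, G i ∈ homZ K (Fin 3) (t - d i)) ∧ ∑ i, G i * f i = p := by
  obtain ⟨G, hG⟩ := Ideal.mem_span_range_iff_exists_fun.1 hmem
  refine ⟨fun i ↦ compZ (t - d i) (G i), fun i ↦ compZ_mem _ _, ?_⟩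
  have := congrArg (compZ t) hG
  rw [compZ_of_mem hp, if_pos rfl, map_sum] at this
  rw [← this]
  exact Finset.sum_congr rfl fun i _ ↦ (compZ_mul _ (hf i)).symm

theorem exists_linear_form_injective_or_surjective [CharZero K] {f : Fin 3 → MvPolynomial (Fin 3) K} {d : Fin 3 → ℕ}
    (hf : ∀ i, f i ∈ homZ K (Fin 3) (d i)) {N : ℕ}
    (hN : ∀ i, X i ^ N ∈ Ideal.span (Set.range f)) :
    ∃ ℓ ∈ homZ K (Fin 3) 1, ∀ t : ℤ,
      (∀ w ∈ homZ K (Fin 3) t, ℓ * w ∈ Ideal.span (Set.range f) → w ∈ Ideal.span (Set.range f)) ∨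
      (∀ q ∈ homZ K (Fin 3) (t + 1), ∃ w ∈ homZ K (Fin 3) t,
        ℓ * w - q ∈ Ideal.span (Set.range f)) := by
  obtain ⟨u, v, a, b, g, h, c, hab, hsum, hg, hh, hc, hgh, hgprim, hlift⟩ :=
    exists_line_syzygy_basis hf hN
  have hprim := isPrimitiveTriple_restrictPlane u v hN
  have hf' : ∀ i, restrictPlane u v (f i) ∈ homZ K (Fin 2) (d i) :=
    fun i ↦ restrictPlane_mem_homZ u v (hf i)
  have hspan : ∀ G : Fin 3 → MvPolynomial (Fin 3) K, ∑ i, G i * f i ∈ Ideal.span (Set.range f) :=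
    fun G ↦ Ideal.mem_span_range_iff_exists_fun.2 ⟨G, rfl⟩
  set ℓ : MvPolynomial (Fin 3) K := X 2 - C u * X 0 - C v * X 1 with hℓ
  have hℓ1 : ℓ ∈ homZ K (Fin 3) 1 := sub_mem (sub_mem (X_mem_homZ _)
    (C_mul_mem_homZ _ (X_mem_homZ _))) (C_mul_mem_homZ _ (X_mem_homZ _))
  have hℓ0 : ℓ ≠ 0 := by
    intro h0
    have := congrArg (aeval ![(0 : K), 0, 1]) h0
    simp [hℓ] at this
  refine ⟨ℓ, hℓ1, fun t ↦ ?_⟩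
  by_cases ht : b - 1 ≤ t + 1
  · right
    intro q hq
    by_cases ht0 : 0 ≤ t + 1
    · obtain ⟨p, hp, hpq⟩ := surjective_of_syzygy_basis hf' hprim hgprim hab hsum hg hh hc hgh ht ht0
        (restrictPlane_mem_homZ u v hq)
      obtain ⟨w, hw⟩ := dvd_of_restrictPlane_eq_zero u v
        (p := q - ∑ i, inclPlane (p i) * f i) (by
          simp only [map_sub, map_sum, map_mul, restrictPlane_inclPlane, hpq, sub_self])
      rw [← hℓ] at hw
      refine ⟨w, ?_, ?_⟩
      · have h1 : w * ℓ ∈ homZ K (Fin 3) (t + 1) := by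
          rw [mul_comm, ← hw]
          refine sub_mem hq (sum_mem fun i _ ↦ ?_)
          simpa using mul_mem_homZ (inclPlane_mem_homZ (hp i)) (hf i)
        simpa using mem_homZ_of_mul_right hℓ1 hℓ0 h1
      · rw [← hw, sub_sub_cancel_left]
        exact neg_mem (hspan _)
    · exact ⟨0, zero_mem _, by simp [eq_zero_of_mem_homZ_of_neg (by omega) hq]⟩
  · left
    intro w hw hmem
    obtain ⟨G, hG, hGw⟩ := exists_homZ_of_mem_span hf (mul_mem_homZ hℓ1 hw) hmem
    have hGsyz : (fun i ↦ restrictPlane u v (G i)) ∈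
        syzZ (fun i ↦ restrictPlane u v (f i)) d (1 + t) := by
      refine ⟨fun i ↦ restrictPlane_mem_homZ u v (hG i), ?_⟩
      have := congrArg (restrictPlane u v) hGw
      simpa only [map_sum, map_mul, hℓ, restrictPlane_linear, zero_mul] using this
    have hcr := crossProduct_eq_zero_of_lt hf' hprim hg hGsyz (by omega)
    obtain ⟨e, he⟩ := hgprim.exists_eq_mul (v := fun i ↦ restrictPlane u v (G i)) fun i j ↦ by
      have := crossProduct_eq_zero_iff.1 hcr j i
      rw [mul_comm, this, mul_comm]
    obtain ⟨H, hH, hH0⟩ : ∃ H : Fin 3 → MvPolynomial (Fin 3) K,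
        (∀ i, restrictPlane u v (H i) = restrictPlane u v (G i)) ∧ ∑ i, H i * f i = 0 := by
      by_cases hta : 1 + t < a
      · refine ⟨0, fun i ↦ ?_, by simp⟩
        obtain ⟨j, hj⟩ := hgprim.exists_ne_zero
        have h1 := hGsyz.1 j
        simp only [he j] at h1
        have h2 := mem_homZ_of_mul_right (hg.1 j) hj h1
        have h3 := eq_zero_of_mem_homZ_of_neg (by omega) h2
        have h4 := he i
        rw [h3, zero_mul] at h4
        rw [h4]; simp
      · obtain ⟨H, hH, hH0⟩ := hlift (by omega)
        refine ⟨fun i ↦ inclPlane e * H i, fun i ↦ ?_, ?_⟩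
        · rw [map_mul, restrictPlane_inclPlane, hH]
          exact (he i).symm
        · simp only [mul_assoc, ← Finset.mul_sum, hH0, mul_zero]
    choose W hW using fun i ↦ dvd_of_restrictPlane_eq_zero u v (p := G i - H i) (by
      rw [map_sub, hH, sub_self])
    have : w = ∑ i, W i * f i := by
      refine mul_left_cancel₀ hℓ0 ?_
      rw [← hGw, Finset.mul_sum, ← sub_zero (∑ i, G i * f i), ← hH0, ← Finset.sum_sub_distrib]
      exact Finset.sum_congr rfl fun i _ ↦ by rw [← sub_mul, hW, mul_assoc]
    rw [this]
    exact hspan W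

end Lefschetz

end

/-- Let `K` be an algebraically closed field of characteristic zero
and `R = K[x,y,z]`.  If `f₁, f₂, f₃` is a regular sequence of homogeneous polynomials
of positive degree in `R` and `I = (f₁, f₂, f₃)`, then the Artinian algebra `R/I` has
the Weak Lefschetz Property. -/
theorem stmt10 {K : Type*} [Field K] [IsAlgClosed K] [CharZero K]
    (f₁ f₂ f₃ : MvPolynomial (Fin 3) K)
    (e₁ e₂ e₃ : ℕ) (he₁ : 0 < e₁) (he₂ : 0 < e₂) (he₃ : 0 < e₃)
    (hf₁ : f₁.IsHomogeneous e₁) (hf₂ : f₂.IsHomogeneous e₂) (hf₃ : f₃.IsHomogeneous e₃)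
    (hreg : RingTheory.Sequence.IsRegular (MvPolynomial (Fin 3) K) [f₁, f₂, f₃])
    (I : Ideal (MvPolynomial (Fin 3) K)) (hI : I = Ideal.span {f₁, f₂, f₃}) :
    ∃ ℓ : MvPolynomial (Fin 3) K, ℓ.IsHomogeneous 1 ∧
      ∀ t : ℤ,
        (∀ x ∈ quotPiece I t, ℓ • x = 0 → x = 0) ∨
        (∀ y ∈ quotPiece I (t + 1), ∃ x ∈ quotPiece I t, ℓ • x = y) := by
  have hrange : Set.range ![f₁, f₂, f₃] = {f₁, f₂, f₃} := by
    ext x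
    simp [eq_comm]
    tauto
  have hlist : Ideal.ofList [f₁, f₂, f₃] = I := by
    rw [hI, Ideal.ofList]
    congr 1
    ext x
    simp
  have hI' : I = Ideal.span (Set.range ![f₁, f₂, f₃]) := by rw [hI, hrange]
  obtain ⟨N, hN⟩ := exists_X_pow_mem_of_isWeaklyRegular [f₁, f₂, f₃] rfl hreg.toIsWeaklyRegular
    (by
      intro f hf
      simp only [List.mem_cons, List.not_mem_nil, or_false] at hf
      rcases hf with rfl | rfl | rfl
      · exact ⟨e₁, he₁, hf₁⟩
      · exact ⟨e₂, he₂, hf₂⟩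
      · exact ⟨e₃, he₃, hf₃⟩)
  rw [hlist] at hN
  obtain ⟨ℓ, hℓ, H⟩ := exists_linear_form_injective_or_surjective (f := ![f₁, f₂, f₃]) (d := ![e₁, e₂, e₃]) (N := N)
    (fun i ↦ by
      fin_cases i
      · exact mem_homZ_natCast.2 hf₁
      · exact mem_homZ_natCast.2 hf₂
      · exact mem_homZ_natCast.2 hf₃)
    (fun i ↦ hI' ▸ hN i)
  rw [← hI'] at H
  refine ⟨ℓ, mem_homZ_natCast.1 (by exact_mod_cast hℓ), fun t ↦ (H t).imp ?_ ?_⟩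
  · intro h x hx hℓx
    obtain ⟨w, hw, rfl⟩ := mem_quotPiece_iff.1 hx
    exact Ideal.Quotient.eq_zero_iff_mem.2 (h w hw (Ideal.Quotient.eq_zero_iff_mem.1 hℓx))
  · intro h y hy
    obtain ⟨q, hq, rfl⟩ := mem_quotPiece_iff.1 hy
    obtain ⟨w, hw, hwq⟩ := h q hq
    exact ⟨_, mem_quotPiece_iff.2 ⟨w, hw, rfl⟩, Ideal.Quotient.eq.2 hwq⟩
end

section
/- Let N be an Artinian non-negatively graded S-module with Hilbert function h_N. Suppose h_N(i) ≤ h_N(i+1) ≤ h_N(i+2) and Soc(N)_i = 0 (the degree-i component of the socle (0 :_N m) vanishes). Then, as sets, L_{N,i} ⊆ L_{N,i+1}: every linear form ℓ for which ×ℓ : N_i → N_{i+1} fails to have maximal rank (equivalently, fails to be injective) also has the property that ×ℓ : N_{i+1} → N_{i+2} fails to have maximal rank (equivalently, fails to be injective). -/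
open MvPolynomial

/-- Let `N` be an Artinian non-negatively graded module over
`S = K[x₁,…,x_r]` with Hilbert function `h_N`.  Suppose
`h_N(i) ≤ h_N(i+1) ≤ h_N(i+2)` and the degree-`i` piece of the socle `(0 :_N m)`
vanishes.  Then, as sets, `𝔏_{N,i} ⊆ 𝔏_{N,i+1}`: every linear form `ℓ` for which
`×ℓ : N_i → N_{i+1}` fails to be injective (equivalently, fails to have maximal
rank) is such that `×ℓ : N_{i+1} → N_{i+2}` also fails to be injective. -/
theorem stmt15 {K : Type*} [Field K] [IsAlgClosed K] [CharZero K] (r : ℕ)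
    {N : Type*} [AddCommGroup N] [Module K N]
    [Module (MvPolynomial (Fin r) K) N]
    [IsScalarTower K (MvPolynomial (Fin r) K) N]
    -- the grading of `N` by `K`-subspaces
    (𝒩 : ℤ → Submodule K N)
    (hdecomp : DirectSum.IsInternal 𝒩)
    (hgrmul : ∀ (m : ℕ) (p : MvPolynomial (Fin r) K), p.IsHomogeneous m →
      ∀ (j : ℤ), ∀ x ∈ 𝒩 j, p • x ∈ 𝒩 (j + m))
    -- `N` is Artinian and non-negatively graded
    (hart : IsArtinian (MvPolynomial (Fin r) K) N)
    (hneg : ∀ j : ℤ, j < 0 → 𝒩 j = ⊥)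
    (i : ℤ)
    -- `h_N(i) ≤ h_N(i+1) ≤ h_N(i+2)`
    (hh1 : Module.finrank K (𝒩 i) ≤ Module.finrank K (𝒩 (i + 1)))
    (hh2 : Module.finrank K (𝒩 (i + 1)) ≤ Module.finrank K (𝒩 (i + 2)))
    -- `Soc(N)_i = 0`
    (hsoc : ∀ x ∈ 𝒩 i, (∀ k : Fin r, (X k : MvPolynomial (Fin r) K) • x = 0) → x = 0) :
    ∀ ℓ : MvPolynomial (Fin r) K, ℓ.IsHomogeneous 1 →
      (∃ x ∈ 𝒩 i, ℓ • x = 0 ∧ x ≠ 0) →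
      (∃ y ∈ 𝒩 (i + 1), ℓ • y = 0 ∧ y ≠ 0) := by
  rintro ℓ - ⟨x, hx, hℓx, hx0⟩
  obtain ⟨k, hk⟩ : ∃ k : Fin r, (X k : MvPolynomial (Fin r) K) • x ≠ 0 := by
    by_contra! h
    exact hx0 (hsoc x hx h)
  refine ⟨(X k : MvPolynomial (Fin r) K) • x, ?_, ?_, hk⟩
  · exact_mod_cast hgrmul 1 (X k) (isHomogeneous_X K k) i x hx
  · rw [smul_comm, hℓx, smul_zero]
end

section
/- Let N = S^v/L, where L is a homogeneous S-submodule of S^v generated by elements of positive degree, and suppose N is Artinian and level with maximal socle degree c. Then there exists an integer j such that, as sets, L_N = L_{N,j−1} ∪ L_{N,j}; that is, a linear form ℓ ∈ S_1 is a Lefschetz element of N if and only if ×ℓ : N_{j−1} → N_j and ×ℓ : N_j → N_{j+1} both have maximal rank. -/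
open MvPolynomial

noncomputable section

/-- The degree-`t` graded piece of the quotient `N = S^v / L` of the standardly graded
free module `S^v` by a homogeneous submodule `L`: the image of the degree-`t` piece
of `S^v`. -/
def piece {K : Type*} [Field K] {r v : ℕ}
    (L : Submodule (MvPolynomial (Fin r) K) (Fin v → MvPolynomial (Fin r) K)) (t : ℤ) :
    Submodule K ((Fin v → MvPolynomial (Fin r) K) ⧸ L) :=
  (Submodule.pi Set.univ fun _ => hcomp K r t).map (L.mkQ.restrictScalars K)

/-- `L ⊆ S^v` is generated by homogeneous elements of positive degree. -/
def posDegGen {K : Type*} [Field K] {r v : ℕ}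
    (L : Submodule (MvPolynomial (Fin r) K) (Fin v → MvPolynomial (Fin r) K)) : Prop :=
  ∃ G : Set (Fin v → MvPolynomial (Fin r) K),
    L = Submodule.span (MvPolynomial (Fin r) K) G ∧
    ∀ w ∈ G, ∃ e : ℕ, 0 < e ∧ ∀ i, (w i).IsHomogeneous e

end

section GradedPieces

variable {K : Type*} [Field K] {r v : ℕ}
  {L : Submodule (MvPolynomial (Fin r) K) (Fin v → MvPolynomial (Fin r) K)}

lemma mem_hcomp_natCast (n : ℕ) (p : MvPolynomial (Fin r) K) :
    p ∈ hcomp K r (n : ℤ) ↔ p.IsHomogeneous n := by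
  simp [hcomp]

lemma mkQ_mem_piece {n : ℕ} {w : Fin v → MvPolynomial (Fin r) K}
    (hw : ∀ i, (w i).IsHomogeneous n) : L.mkQ w ∈ piece L (n : ℤ) :=
  ⟨w, fun i _ => (mem_hcomp_natCast n (w i)).2 (hw i), rfl⟩

lemma exists_of_mem_piece {n : ℕ} {x : (Fin v → MvPolynomial (Fin r) K) ⧸ L}
    (hx : x ∈ piece L (n : ℤ)) :
    ∃ w : Fin v → MvPolynomial (Fin r) K, (∀ i, (w i).IsHomogeneous n) ∧ L.mkQ w = x := by
  obtain ⟨w, hw, rfl⟩ := hx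
  exact ⟨w, fun i => (mem_hcomp_natCast n (w i)).1 (hw i trivial), rfl⟩

lemma piece_eq_bot_of_neg {t : ℤ} (ht : t < 0) : piece L t = ⊥ := by
  rw [eq_bot_iff]
  rintro x ⟨w, hw, rfl⟩
  have hw0 : w = 0 := by
    funext i
    have := hw i trivial
    simpa [hcomp, not_le.2 ht] using this
  simp [hw0]

lemma smul_mem_piece {ℓ : MvPolynomial (Fin r) K} (hℓ : ℓ.IsHomogeneous 1) {t : ℤ}
    {x : (Fin v → MvPolynomial (Fin r) K) ⧸ L} (hx : x ∈ piece L t) :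
    ℓ • x ∈ piece L (t + 1) := by
  rcases lt_or_ge t 0 with ht | ht
  · rw [piece_eq_bot_of_neg ht, Submodule.mem_bot] at hx
    simp [hx]
  · lift t to ℕ using ht
    obtain ⟨w, hw, rfl⟩ := exists_of_mem_piece hx
    rw [← map_smul]
    exact_mod_cast mkQ_mem_piece (n := t + 1) fun i => by
      simpa [add_comm] using hℓ.mul (hw i)

/-- A submodule generated by homogeneous elements contains the homogeneous components of
its elements. -/
lemma homogeneousComponent_mem (hL : posDegGen L) {w : Fin v → MvPolynomial (Fin r) K}
    (hw : w ∈ L) (n : ℕ) : (fun i => homogeneousComponent n (w i)) ∈ L := by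
  obtain ⟨G, rfl, hG⟩ := hL
  suffices h : ∀ a : MvPolynomial (Fin r) K,
      (fun i => homogeneousComponent n ((a • w) i)) ∈ Submodule.span (MvPolynomial (Fin r) K) G by
    simpa using h 1
  induction hw using Submodule.span_induction with
  | mem g hg =>
    intro a
    obtain ⟨e, -, he⟩ := hG g hg
    have key : (fun i => homogeneousComponent n ((a • g) i)) =
        ∑ k ∈ Finset.range (a.totalDegree + 1),
          (if k + e = n then homogeneousComponent k a else 0) • g := by
      funext i
      conv_lhs => rw [← sum_homogeneousComponent a]
      simp only [Pi.smul_apply, smul_eq_mul, Finset.sum_mul, map_sum, Finset.sum_apply]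
      refine Finset.sum_congr rfl fun k _ => ?_
      rw [homogeneousComponent_of_mem ((homogeneousComponent_isHomogeneous k a).mul (he i))]
      split_ifs <;> simp_all
    rw [key]
    exact Submodule.sum_mem _ fun k _ => Submodule.smul_mem _ _ (Submodule.subset_span hg)
  | zero =>
    intro a
    simp only [smul_zero, Pi.zero_apply, map_zero]
    exact Submodule.zero_mem _
  | add x y _ _ hx hy =>
    intro a
    have := Submodule.add_mem _ (hx a) (hy a)
    convert this using 1
    funext i
    simp [mul_add]
  | smul b x _ hx =>
    intro a
    simpa [smul_smul, mul_assoc] using hx (a * b)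

lemma eq_zero_of_mem_piece_of_mem_piece (hL : posDegGen L) {s t : ℤ} (hst : s ≠ t)
    {x : (Fin v → MvPolynomial (Fin r) K) ⧸ L} (hs : x ∈ piece L s) (ht : x ∈ piece L t) :
    x = 0 := by
  rcases lt_or_ge s 0 with hs0 | hs0
  · simpa [piece_eq_bot_of_neg hs0] using hs
  rcases lt_or_ge t 0 with ht0 | ht0
  · simpa [piece_eq_bot_of_neg ht0] using ht
  lift s to ℕ using hs0
  lift t to ℕ using ht0
  obtain ⟨p, hp, rfl⟩ := exists_of_mem_piece hs
  obtain ⟨q, hq, hqp⟩ := exists_of_mem_piece ht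
  have hmem : p - q ∈ L := by
    rw [← Submodule.ker_mkQ L, LinearMap.mem_ker, map_sub, hqp, sub_self]
  have hcomp_mem := homogeneousComponent_mem hL hmem s
  have hps : (fun i => homogeneousComponent s ((p - q) i)) = p := by
    funext i
    have hne : t ≠ s := fun h => hst (by rw [h])
    rw [Pi.sub_apply, map_sub, homogeneousComponent_of_mem (hp i),
      homogeneousComponent_of_mem (hq i)]
    simp [hne.symm]
  rw [hps] at hcomp_mem
  simpa using hcomp_mem

/-- In nonnegative degrees, `N_{t+1} = S₁ N_t`. -/
lemma piece_succ_le {n : ℕ} {T : Submodule K ((Fin v → MvPolynomial (Fin r) K) ⧸ L)}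
    (hT : ∀ (k : Fin r), ∀ x ∈ piece L (n : ℤ), (X k : MvPolynomial (Fin r) K) • x ∈ T) :
    piece L ((n : ℤ) + 1) ≤ T := by
  intro y hy
  obtain ⟨w, hw, rfl⟩ := exists_of_mem_piece (n := n + 1) (by exact_mod_cast hy)
  rw [← Finset.univ_sum_single w, map_sum]
  refine Submodule.sum_mem _ fun i _ => ?_
  rw [(w i).as_sum]
  let φ : MvPolynomial (Fin r) K →ₗ[K] ((Fin v → MvPolynomial (Fin r) K) ⧸ L) :=
    (L.mkQ.restrictScalars K) ∘ₗ LinearMap.single K (fun _ => MvPolynomial (Fin r) K) i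
  change φ _ ∈ T
  rw [map_sum]
  refine Submodule.sum_mem _ fun d hd => ?_
  have hdeg : d.degree = n + 1 := by
    rw [Finsupp.degree_eq_weight_one]
    exact hw i (mem_support_iff.1 hd)
  obtain ⟨k, hk⟩ : ∃ k, d k ≠ 0 := by
    by_contra! h
    have : d = 0 := Finsupp.ext h
    simp [this] at hdeg
  have hle : Finsupp.single k 1 ≤ d := by
    simpa [Finsupp.single_le_iff] using Nat.one_le_iff_ne_zero.2 hk
  set e := d - Finsupp.single k 1 with he
  have hde : Finsupp.single k 1 + e = d := add_tsub_cancel_of_le hle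
  have hdeg' : e.degree = n := by
    rw [← hde, map_add, Finsupp.degree_single] at hdeg
    omega
  have hmon : monomial d (coeff d (w i)) = X k * monomial e (coeff d (w i)) := by
    rw [X, monomial_mul, hde, one_mul]
  have hφ : φ (monomial d (coeff d (w i))) =
      (X k : MvPolynomial (Fin r) K) • L.mkQ (Pi.single i (monomial e (coeff d (w i)))) := by
    rw [hmon, ← map_smul, ← Pi.single_smul]
    rfl
  rw [hφ]
  refine hT k _ (mkQ_mem_piece fun i' => ?_)
  rcases eq_or_ne i' i with rfl | hne
  · rw [Pi.single_eq_same]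
    exact isHomogeneous_monomial _ hdeg'
  · rw [Pi.single_eq_of_ne hne]
    exact isHomogeneous_zero _ _ _

instance finiteDimensional_piece (t : ℤ) : FiniteDimensional K (piece L t) := by
  have : FiniteDimensional K (hcomp K r t) := by
    rw [hcomp]
    refine Module.Finite.iff_fg.2 ?_
    split_ifs
    · exact homogeneousSubmodule_fg _ _ _
    · exact Submodule.fg_bot
  have hinj : Function.Injective (LinearMap.pi fun i : Fin v =>
      ((LinearMap.proj i).comp (Submodule.subtype
        (Submodule.pi Set.univ fun _ : Fin v => hcomp K r t))).codRestrict (hcomp K r t)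
        fun w => w.2 i trivial) := by
    intro a b hab
    ext i : 2
    exact congrArg Subtype.val (congrFun hab i)
  have := FiniteDimensional.of_injective _ hinj
  unfold piece
  infer_instance

/-- Surjectivity of multiplication by `ℓ` propagates to higher degrees. -/
lemma piece_le_map_of_le {ℓ : MvPolynomial (Fin r) K} {j : ℤ} (hj : 0 ≤ j)
    (h : ∀ y ∈ piece L (j + 1), ∃ x ∈ piece L j, ℓ • x = y) {t : ℤ} (ht : j ≤ t) :
    ∀ y ∈ piece L (t + 1), ∃ x ∈ piece L t, ℓ • x = y := by
  induction t, ht using Int.leInduction with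
  | base => exact h
  | succ t hjt ih =>
    let f := (LinearMap.lsmul (MvPolynomial (Fin r) K)
      ((Fin v → MvPolynomial (Fin r) K) ⧸ L) ℓ).restrictScalars K
    have hle : piece L (t + 1 + 1) ≤ (piece L (t + 1)).map f := by
      lift t to ℕ using hj.trans hjt
      refine piece_succ_le (n := t + 1) fun k x hx => ?_
      obtain ⟨z, hz, rfl⟩ := ih x (by exact_mod_cast hx)
      exact ⟨(X k : MvPolynomial (Fin r) K) • z, smul_mem_piece (isHomogeneous_X K k) hz,
        smul_comm ℓ (X k : MvPolynomial (Fin r) K) z⟩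
    exact fun y hy => hle hy

/-- Injectivity of multiplication by `ℓ` propagates to lower degrees when the socle vanishes
in degrees below `c`. -/
lemma injective_of_le {ℓ : MvPolynomial (Fin r) K} {c j : ℤ} (hj : j ≤ c)
    (hsoc : ∀ t < c, ∀ x ∈ piece L t,
      (∀ k : Fin r, (X k : MvPolynomial (Fin r) K) • x = 0) → x = 0)
    (h : ∀ x ∈ piece L j, ℓ • x = 0 → x = 0) {t : ℤ} (ht : t ≤ j) :
    ∀ x ∈ piece L t, ℓ • x = 0 → x = 0 := by
  induction t, ht using Int.leInductionDown with
  | base => exact h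
  | pred t htj ih =>
    intro x hx hℓx
    refine hsoc (t - 1) (by omega) x hx fun k => ?_
    refine ih _ (by simpa using smul_mem_piece (isHomogeneous_X K k) hx) ?_
    rw [smul_comm, hℓx, smul_zero]

/-- A linear map carrying `P` into `Q` and either injective on `P` or onto `Q` is injective
on `P` if `dim P ≤ dim Q`. -/
lemma injOn_of_finrank_le {V : Type*} [AddCommGroup V] [Module K V] {f : V →ₗ[K] V}
    {P Q : Submodule K V} [FiniteDimensional K P]
    (hmax : (∀ x ∈ P, f x = 0 → x = 0) ∨ ∀ y ∈ Q, ∃ x ∈ P, f x = y)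
    (hle : Module.finrank K P ≤ Module.finrank K Q) : ∀ x ∈ P, f x = 0 → x = 0 := by
  refine hmax.elim id fun hsurj x hx hfx => ?_
  have hQ : Q ≤ LinearMap.range (f.domRestrict P) := fun y hy => by
    obtain ⟨x, hx, rfl⟩ := hsurj y hy
    exact ⟨⟨x, hx⟩, rfl⟩
  have hrank := Submodule.finrank_mono hQ
  have hsum := LinearMap.finrank_range_add_finrank_ker (f.domRestrict P)
  have hker : LinearMap.ker (f.domRestrict P) = ⊥ := Submodule.finrank_eq_zero.1 (by omega)
  have hxker : (⟨x, hx⟩ : P) ∈ LinearMap.ker (f.domRestrict P) := hfx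
  rw [hker, Submodule.mem_bot] at hxker
  exact congrArg Subtype.val hxker

/-- A linear map carrying `P` into `Q` and either injective on `P` or onto `Q` is onto `Q`
if `dim Q ≤ dim P`. -/
lemma surjOn_of_finrank_le {V : Type*} [AddCommGroup V] [Module K V] {f : V →ₗ[K] V}
    {P Q : Submodule K V} [FiniteDimensional K Q] (hPQ : ∀ x ∈ P, f x ∈ Q)
    (hmax : (∀ x ∈ P, f x = 0 → x = 0) ∨ ∀ y ∈ Q, ∃ x ∈ P, f x = y)
    (hle : Module.finrank K Q ≤ Module.finrank K P) : ∀ y ∈ Q, ∃ x ∈ P, f x = y := by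
  refine hmax.elim (fun hinj y hy => ?_) id
  have hrange : LinearMap.range (f.domRestrict P) ≤ Q := by
    rintro _ ⟨x, rfl⟩
    exact hPQ x x.2
  have hfi : Function.Injective (f.domRestrict P) := by
    rw [← LinearMap.ker_eq_bot, LinearMap.ker_eq_bot']
    exact fun x hx => Subtype.ext (hinj x x.2 hx)
  have heq := Submodule.eq_of_le_of_finrank_le hrange
    (by rw [LinearMap.finrank_range_of_inj hfi]; exact hle)
  rw [← heq] at hy
  obtain ⟨x, rfl⟩ := hy
  exact ⟨x, x.2, rfl⟩

end GradedPieces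

/-- Let `N = S^v/L` (`L` homogeneous, generated in positive degrees)
be Artinian and level with maximal socle degree `c`.  Then there exists an integer `j`
such that, as sets, `𝔏_N = 𝔏_{N,j-1} ∪ 𝔏_{N,j}`; that is, a linear form `ℓ ∈ S₁` is a
Lefschetz element of `N` if and only if both `×ℓ : N_{j-1} → N_j` and
`×ℓ : N_j → N_{j+1}` have maximal rank (are injective or surjective). -/
theorem stmt16 {K : Type*} [Field K] [IsAlgClosed K] [CharZero K] (r v : ℕ)
    (L : Submodule (MvPolynomial (Fin r) K) (Fin v → MvPolynomial (Fin r) K))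
    (hL : posDegGen L)
    (hart : IsArtinian (MvPolynomial (Fin r) K) ((Fin v → MvPolynomial (Fin r) K) ⧸ L))
    -- `N = N₀ ⊕ … ⊕ N_c` with `N_c ≠ 0`, and `N` is level: `Soc(N) = N_c`
    (c : ℤ) (htop : ∀ t : ℤ, c < t → piece L t = ⊥) (hc : piece L c ≠ ⊥)
    (hlevel : {x : (Fin v → MvPolynomial (Fin r) K) ⧸ L |
        ∀ k : Fin r, (X k : MvPolynomial (Fin r) K) • x = 0} = (piece L c : Set _)) :
    ∃ j : ℤ, ∀ ℓ : MvPolynomial (Fin r) K, ℓ.IsHomogeneous 1 →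
      ((∀ t : ℤ,
          (∀ x ∈ piece L t, ℓ • x = 0 → x = 0) ∨
          (∀ y ∈ piece L (t + 1), ∃ x ∈ piece L t, ℓ • x = y)) ↔
        (((∀ x ∈ piece L (j - 1), ℓ • x = 0 → x = 0) ∨
            (∀ y ∈ piece L j, ∃ x ∈ piece L (j - 1), ℓ • x = y)) ∧
          ((∀ x ∈ piece L j, ℓ • x = 0 → x = 0) ∨
            (∀ y ∈ piece L (j + 1), ∃ x ∈ piece L j, ℓ • x = y)))) := by
  have hc0 : 0 ≤ c := by
    by_contra! h
    exact hc (piece_eq_bot_of_neg h)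
  have hsoc : ∀ t < c, ∀ x ∈ piece L t,
      (∀ k : Fin r, (X k : MvPolynomial (Fin r) K) • x = 0) → x = 0 := by
    intro t ht x hx hk
    have hxc : x ∈ (piece L c : Set _) := hlevel ▸ hk
    exact eq_zero_of_mem_piece_of_mem_piece hL ht.ne hx hxc
  obtain ⟨j, hj, hjmax⟩ := Finset.exists_max_image (Finset.Icc 0 c)
    (fun t => Module.finrank K (piece L t)) ⟨0, Finset.mem_Icc.2 ⟨le_rfl, hc0⟩⟩
  obtain ⟨hj0, hjc⟩ := Finset.mem_Icc.1 hj
  have hmax : ∀ t, Module.finrank K (piece L t) ≤ Module.finrank K (piece L j) := by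
    intro t
    by_cases ht : t ∈ Finset.Icc 0 c
    · exact hjmax t ht
    · have hbot : piece L t = ⊥ := by
        rw [Finset.mem_Icc, not_and_or, not_le, not_le] at ht
        exact ht.elim piece_eq_bot_of_neg (htop t)
      rw [hbot, finrank_bot]
      exact Nat.zero_le _
  refine ⟨j, fun ℓ hℓ => ⟨fun h => ⟨by simpa using h (j - 1), h j⟩, ?_⟩⟩
  rintro ⟨hprev, hnext⟩ t
  let f := (LinearMap.lsmul (MvPolynomial (Fin r) K)
    ((Fin v → MvPolynomial (Fin r) K) ⧸ L) ℓ).restrictScalars K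
  rcases lt_or_ge t j with htj | htj
  · left
    exact injective_of_le (by omega) hsoc
      (injOn_of_finrank_le (f := f) hprev (hmax (j - 1))) (Int.le_sub_one_of_lt htj)
  · right
    exact piece_le_map_of_le hj0
      (surjOn_of_finrank_le (f := f) (fun _ hx => smul_mem_piece hℓ hx) hnext (hmax (j + 1))) htj
end
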